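/- L_{6/5,2}→L₂ estimate for the gradient heat potential (inequality (imbedding)): Let Γ(x,t)=(4πt)^{−3/2} exp(−|x|²/(4t)) for t>0 and Γ(x,t)=0 for t≤0 (the fundamental solution of the heat operator in ℝ³). There exists an absolute constant c>0 with the following property: for every smooth matrix-valued function G:ℝ³×ℝ→ℝ^{3×3} with compact support contained in ℝ³×(−1,0), the function Ĥ defined for (x,t)∈ℝ³×(−1,0) by Ĥ_i(x,t) = −Σ_j ∫_{−1}^{t} ∫_{ℝ³} (∂_{x_j}Γ)(x−y, t−s) G_{ij}(y,s) dy ds satisfies ( ∫_{−1}^0 ∫_{B(1)} |Ĥ(x,t)|² dx dt )^{1/2} ≤ c ( ∫_{−1}^0 ( ∫_{ℝ³} |G(y,s)|^{6/5} dy )^{5/3} ds )^{1/2}. -/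

import Mathlib

open MeasureTheory Real Set

noncomputable section

abbrev V3 := Fin 3 → ℝ

/-- Euclidean norm on ℝ³. -/
def euclNorm (x : V3) : ℝ := Real.sqrt (∑ i, (x i)^2)

/-- Half ball B⁺(r). -/
def Bp (r : ℝ) : Set V3 := {x | euclNorm x < r ∧ 0 < x 2}

/-- Full ball B(r). -/
def Bfull (r : ℝ) : Set V3 := {x | euclNorm x < r}

/-- Parabolic half cylinder Q⁺(r). -/
def Qp (r : ℝ) : Set (V3 × ℝ) := (Bp r) ×ˢ (Ioo (-r^2) 0)

/-- Full parabolic cylinder Q(r). -/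
def Qfull (r : ℝ) : Set (V3 × ℝ) := (Bfull r) ×ˢ (Ioo (-r^2) 0)

/-- Spatial partial derivative ∂ⱼ f (x). -/
def pd (f : V3 → ℝ) (j : Fin 3) (x : V3) : ℝ := fderiv ℝ f x (Pi.single j 1)

/-- Spatial Laplacian. -/
def lap (f : V3 → ℝ) (x : V3) : ℝ := ∑ j, pd (fun y => pd f j y) j x

/-- Squared norm of the spatial gradient of a scalar function. -/
def gradSq (f : V3 → ℝ) (x : V3) : ℝ := ∑ j, (pd f j x)^2

/-- Squared Frobenius norm of the spatial gradient of a vector field. -/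
def gradVSq (u : V3 → ℝ → V3) (t : ℝ) (x : V3) : ℝ :=
  ∑ i, ∑ j, (pd (fun y => u y t i) j x)^2

/-- Cross product in ℝ³. -/
def cross3 (a b : V3) : V3 :=
  ![a 1 * b 2 - a 2 * b 1, a 2 * b 0 - a 0 * b 2, a 0 * b 1 - a 1 * b 0]

/-- Curl of a vector field. -/
def curl3 (u : V3 → V3) (x : V3) : V3 :=
  ![pd (fun y => u y 2) 1 x - pd (fun y => u y 1) 2 x,
    pd (fun y => u y 0) 2 x - pd (fun y => u y 2) 0 x,
    pd (fun y => u y 1) 0 x - pd (fun y => u y 0) 1 x]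

/-- Divergence of a vector field. -/
def div3 (u : V3 → V3) (x : V3) : ℝ := ∑ j, pd (fun y => u y j) j x

/-- A(r) : scaled energy sup functional. -/
def funcA (v : V3 → ℝ → V3) (r : ℝ) : ℝ :=
  (r⁻¹ * sSup ((fun t => ∫ x in Bp r, euclNorm (v x t)^2) '' Ioo (-r^2) 0)) ^ (1/2 : ℝ)

/-- E(r) : scaled Dirichlet energy. -/
def funcE (v : V3 → ℝ → V3) (r : ℝ) : ℝ :=
  (r⁻¹ * ∫ t in Ioo (-r^2) 0, ∫ x in Bp r, gradVSq v t x) ^ (1/2 : ℝ)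

/-- C_q(r) (for v), F_q(r) (for H). -/
def funcCq (v : V3 → ℝ → V3) (q r : ℝ) : ℝ :=
  (r ^ (q - 5) * ∫ t in Ioo (-r^2) 0, ∫ x in Bp r, euclNorm (v x t) ^ q) ^ (1/q)

def funcC (v : V3 → ℝ → V3) (r : ℝ) : ℝ := funcCq v 3 r
def funcF (H : V3 → ℝ → V3) (r : ℝ) : ℝ := funcCq H 3 r
def funcF2 (H : V3 → ℝ → V3) (r : ℝ) : ℝ := funcCq H 2 r

/-- D_s(r) : scaled pressure-gradient functional. -/
def funcD (p : V3 → ℝ → ℝ) (s r : ℝ) : ℝ :=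
  r ^ ((5:ℝ)/3 - 3/s) *
    (∫ t in Ioo (-r^2) 0,
      (∫ x in Bp r, Real.sqrt (gradSq (fun y => p y t) x) ^ s) ^ (3/(2*s))) ^ ((2:ℝ)/3)

/-- Flat-boundary conditions on {x₃ = 0, |x| ≤ R, -R² ≤ t ≤ 0} :
v = 0, H₃ = 0, ∂₃H₁ = ∂₃H₂ = 0. -/
def FlatBC (R : ℝ) (v H : V3 → ℝ → V3) : Prop :=
  ∀ x : V3, ∀ t : ℝ, euclNorm x ≤ R → x 2 = 0 → -R^2 ≤ t → t ≤ 0 →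
    v x t = 0 ∧ H x t 2 = 0 ∧
    pd (fun y => H y t 0) 2 x = 0 ∧ pd (fun y => H y t 1) 2 x = 0

/-- Smooth MHD solution in Q⁺(R) with flat-boundary conditions. -/
def IsMHD (R : ℝ) (v H : V3 → ℝ → V3) (p : V3 → ℝ → ℝ) : Prop :=
  ContDiffOn ℝ (⊤ : ℕ∞) (fun z : V3 × ℝ => v z.1 z.2) (closure (Qp R)) ∧
  ContDiffOn ℝ (⊤ : ℕ∞) (fun z : V3 × ℝ => H z.1 z.2) (closure (Qp R)) ∧
  ContDiffOn ℝ (⊤ : ℕ∞) (fun z : V3 × ℝ => p z.1 z.2) (closure (Qp R)) ∧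
  (∀ z : V3 × ℝ, z ∈ Qp R → ∀ i : Fin 3,
     deriv (fun s => v z.1 s i) z.2
       + (∑ j, v z.1 z.2 j * pd (fun y => v y z.2 i) j z.1)
       - lap (fun y => v y z.2 i) z.1
       + pd (fun y => p y z.2) i z.1
     = cross3 (curl3 (fun y => H y z.2) z.1) (H z.1 z.2) i) ∧
  (∀ z : V3 × ℝ, z ∈ Qp R → div3 (fun y => v y z.2) z.1 = 0) ∧
  (∀ z : V3 × ℝ, z ∈ Qp R → ∀ i : Fin 3,
     deriv (fun s => H z.1 s i) z.2 + curl3 (fun y => curl3 (fun w => H w z.2) y) z.1 i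
     = curl3 (fun y => cross3 (v y z.2) (H y z.2)) z.1 i) ∧
  (∀ z : V3 × ℝ, z ∈ Qp R → div3 (fun y => H y z.2) z.1 = 0) ∧
  FlatBC R v H

/-- The fundamental solution of the heat operator in ℝ³. -/
def heatKernel (x : V3) (t : ℝ) : ℝ :=
  if 0 < t then (4 * π * t) ^ (-(3:ℝ)/2) * Real.exp (-(∑ i, (x i)^2) / (4 * t))
  else 0

/-- The gradient heat potential Ĥᵢ(x,t) = −Σⱼ ∫_{−1}^{t} ∫_{ℝ³}
(∂ⱼΓ)(x−y,t−s) Gᵢⱼ(y,s) dy ds. -/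
def Hhat (G : V3 → ℝ → (Fin 3 → Fin 3 → ℝ)) (i : Fin 3) (x : V3) (t : ℝ) : ℝ :=
  -∑ j, ∫ s in Ioo (-1 : ℝ) t, ∫ y : V3,
    pd (fun w => heatKernel w (t - s)) j (x - y) * G y s i j

open scoped ENNReal

lemma hk_pos {τ : ℝ} (h : 0 < τ) (w : V3) : heatKernel w τ =
    (4 * π * τ) ^ (-(3:ℝ)/2) * Real.exp (-(∑ i, (w i)^2) / (4 * τ)) := by
  simp [heatKernel, h]

lemma hk_nonneg (w : V3) (τ : ℝ) : 0 ≤ heatKernel w τ := by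
  unfold heatKernel
  split_ifs with h
  · positivity
  · exact le_rfl

lemma hk_le {τ : ℝ} (h : 0 < τ) (w : V3) : heatKernel w τ ≤ (4 * π * τ) ^ (-(3:ℝ)/2) := by
  rw [hk_pos h]
  refine mul_le_of_le_one_right (by positivity) ?_
  rw [Real.exp_le_one_iff]
  have : 0 ≤ ∑ i, (w i)^2 := by positivity
  apply div_nonpos_of_nonpos_of_nonneg <;> linarith

lemma hk_neg (w : V3) (τ : ℝ) : heatKernel (-w) τ = heatKernel w τ := by
  simp [heatKernel]

lemma hk_cont {τ : ℝ} (h : 0 < τ) : Continuous (fun w => heatKernel w τ) := by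
  simp only [hk_pos h]
  fun_prop

lemma hk_meas : Measurable (fun p : V3 × ℝ => heatKernel p.1 p.2) := by
  unfold heatKernel
  refine Measurable.ite (measurableSet_lt measurable_const measurable_snd) ?_ measurable_const
  fun_prop

/-- one-dimensional density -/
def g1 (τ x : ℝ) : ℝ := ProbabilityTheory.gaussianPDFReal 0 (Real.toNNReal (2*τ)) x

lemma g1_eq {τ : ℝ} (h : 0 < τ) (x : ℝ) : g1 τ x = (√(4 * π * τ))⁻¹ * Real.exp (-(4*τ)⁻¹ * x^2) := by
  unfold g1 ProbabilityTheory.gaussianPDFReal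
  rw [Real.coe_toNNReal _ (by positivity)]
  congr 2
  · congr 1; ring_nf
  · congr 1; field_simp; ring

lemma hk_prod {τ : ℝ} (h : 0 < τ) (w : V3) : heatKernel w τ = ∏ i, g1 τ (w i) := by
  rw [hk_pos h]
  simp only [g1_eq h, Finset.prod_mul_distrib, ← Real.exp_sum, Finset.prod_const, Finset.card_univ,
    Fintype.card_fin, ← Finset.mul_sum]
  congr 1
  · rw [Real.sqrt_eq_rpow, ← Real.rpow_neg (by positivity), ← Real.rpow_natCast,
      ← Real.rpow_mul (by positivity)]
    norm_num
  · congr 1; field_simp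

lemma g1_int0 {τ : ℝ} (h : 0 < τ) : ∫ x, g1 τ x = 1 :=
  ProbabilityTheory.integral_gaussianPDFReal_eq_one 0 (by simpa using h)

lemma g1_int1 {τ : ℝ} (h : 0 < τ) : ∫ x, x * g1 τ x = 0 := by
  have h2 : Real.toNNReal (2*τ) ≠ 0 := by simpa using h
  have := ProbabilityTheory.integral_gaussianReal_eq_integral_smul (μ := 0) (f := fun x : ℝ => x) h2
  rw [ProbabilityTheory.integral_id_gaussianReal] at this
  rw [this]
  simp [g1, mul_comm]

lemma g1_int2 {τ : ℝ} (h : 0 < τ) : ∫ x, x^2 * g1 τ x = 2 * τ := by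
  have h2 : Real.toNNReal (2*τ) ≠ 0 := by simpa using h
  have := ProbabilityTheory.integral_gaussianReal_eq_integral_smul (μ := 0) (f := fun x : ℝ => x^2) h2
  have hv := ProbabilityTheory.variance_fun_id_gaussianReal (μ := 0) (v := Real.toNNReal (2*τ))
  rw [ProbabilityTheory.variance_of_integral_eq_zero (by fun_prop)
    (by rw [ProbabilityTheory.integral_id_gaussianReal]), this,
    Real.coe_toNNReal _ (by positivity)] at hv
  rw [← hv]
  simp [g1, mul_comm]

lemma g1_ib0 {τ : ℝ} (h : 0 < τ) : Integrable (fun x => g1 τ x) :=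
  ProbabilityTheory.integrable_gaussianPDFReal _ _

lemma g1_ib1 {τ : ℝ} (h : 0 < τ) : Integrable (fun x => x * g1 τ x) := by
  have := (integrable_mul_exp_neg_mul_sq (b := (4*τ)⁻¹) (by positivity)).const_mul ((√(4 * π * τ))⁻¹)
  refine this.congr (ae_of_all _ fun x => ?_)
  simp only [g1_eq h]; ring

lemma g1_ib2 {τ : ℝ} (h : 0 < τ) : Integrable (fun x => x^2 * g1 τ x) := by
  have := (integrable_rpow_mul_exp_neg_mul_sq (b := (4*τ)⁻¹) (by positivity)
    (s := 2) (by norm_num)).const_mul ((√(4 * π * τ))⁻¹)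
  refine this.congr (ae_of_all _ fun x => ?_)
  simp only [g1_eq h]
  rw [show (2:ℝ) = ((2:ℕ):ℝ) by norm_num, Real.rpow_natCast]; push_cast; ring

lemma hk_ib0 {τ : ℝ} (h : 0 < τ) : Integrable (fun w => heatKernel w τ) := by
  simp only [hk_prod h]
  exact Integrable.fintype_prod (fun _ => g1_ib0 h)

lemma hk_int0 {τ : ℝ} (h : 0 < τ) : ∫ w, heatKernel w τ = 1 := by
  simp only [hk_prod h]
  rw [integral_fintype_prod_volume_eq_prod (fun _ => g1 τ)]
  simp [g1_int0 h]

lemma prod_upd (f : ℝ → ℝ) (τ : ℝ) (j : Fin 3) (w : V3) :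
   f (w j) * ∏ i, g1 τ (w i) = ∏ i, (if i = j then fun x => f x * g1 τ x else g1 τ) (w i) := by
  fin_cases j <;> simp [Fin.prod_univ_three] <;> ring

lemma hk_ibf (f : ℝ → ℝ) {τ : ℝ} (h : 0 < τ) (hf : Integrable (fun x => f x * g1 τ x)) (j : Fin 3) :
    Integrable (fun w : V3 => f (w j) * heatKernel w τ) := by
  simp only [hk_prod h, prod_upd]
  refine Integrable.fintype_prod (f := fun i => (if i = j then fun x => f x * g1 τ x else g1 τ))
    (fun i => ?_)
  split_ifs
  · exact hf
  · exact g1_ib0 h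

lemma hk_intf (f : ℝ → ℝ) {τ : ℝ} (h : 0 < τ) (j : Fin 3) :
    ∫ w : V3, f (w j) * heatKernel w τ = ∫ x, f x * g1 τ x := by
  simp only [hk_prod h, prod_upd]
  rw [integral_fintype_prod_volume_eq_prod (fun i => (if i = j then fun x => f x * g1 τ x else g1 τ))]
  fin_cases j <;> simp [Fin.prod_univ_three, g1_int0 h]

lemma hk_ib1 {τ : ℝ} (h : 0 < τ) (j : Fin 3) : Integrable (fun w : V3 => w j * heatKernel w τ) :=
  hk_ibf (fun x => x) h (g1_ib1 h) j
lemma hk_int1 {τ : ℝ} (h : 0 < τ) (j : Fin 3) : ∫ w : V3, w j * heatKernel w τ = 0 := by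
  rw [hk_intf (fun x => x) h, g1_int1 h]
lemma hk_ib2 {τ : ℝ} (h : 0 < τ) (j : Fin 3) : Integrable (fun w : V3 => (w j)^2 * heatKernel w τ) :=
  hk_ibf (fun x => x^2) h (g1_ib2 h) j
lemma hk_int2 {τ : ℝ} (h : 0 < τ) (j : Fin 3) : ∫ w : V3, (w j)^2 * heatKernel w τ = 2 * τ := by
  rw [hk_intf (fun x => x^2) h, g1_int2 h]

/-- gradient kernel -/
def dk (j : Fin 3) (τ : ℝ) (w : V3) : ℝ := -(w j) / (2*τ) * heatKernel w τ

lemma pd_hk {τ : ℝ} (h : 0 < τ) (j : Fin 3) (w : V3) :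
    pd (fun w => heatKernel w τ) j w = dk j τ w := by
  unfold pd dk
  simp only [hk_pos h]
  have hd : ∀ i : Fin 3, HasFDerivAt (fun w : V3 => w i) (ContinuousLinearMap.proj (R := ℝ) i) w :=
    fun i => (ContinuousLinearMap.proj (R := ℝ) (φ := fun _ : Fin 3 => ℝ) i).hasFDerivAt
  have h1 := HasFDerivAt.fun_sum (u := Finset.univ) (fun i _ => (hd i).pow 2)
  have h2 := (((h1.neg).mul_const (4*τ)⁻¹).exp).const_mul ((4 * π * τ) ^ (-(3:ℝ)/2))
  have h3 := h2.fderiv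
  simp only [div_eq_mul_inv] at h3 ⊢
  erw [h3]
  simp [Pi.single_apply]
  field_simp
  ring

lemma hk_mul {a : ℝ} (h : 0 < a) (x y z : V3) :
    heatKernel (x - z) a * heatKernel (z - y) a =
      heatKernel (x - y) (2*a) * heatKernel (z - (1/2:ℝ) • (x + y)) (a/2) := by
  rw [hk_pos h, hk_pos h, hk_pos (by positivity), hk_pos (by positivity)]
  rw [mul_mul_mul_comm, mul_mul_mul_comm ((4 * π * (2*a)) ^ (-(3:ℝ)/2)), ← Real.exp_add, ← Real.exp_add,
    ← Real.mul_rpow (by positivity) (by positivity), ← Real.mul_rpow (by positivity) (by positivity)]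
  congr 1
  · congr 1; ring
  · congr 1
    simp [Fin.sum_univ_three]
    field_simp
    ring

lemma hk_comp {a : ℝ} (h : 0 < a) (x y : V3) :
    ∫ z, heatKernel (x - z) a * heatKernel (z - y) a = heatKernel (x - y) (2*a) := by
  simp only [hk_mul h]
  rw [integral_const_mul, integral_sub_right_eq_self (fun z => heatKernel z (a/2)),
    hk_int0 (by positivity), mul_one]

lemma dk_comp {a : ℝ} (h : 0 < a) (j : Fin 3) (x y : V3) :
    ∫ z, dk j a (x - z) * heatKernel (z - y) a = dk j (2*a) (x - y) := by
  have h2 : 0 < a / 2 := by positivity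
  set m := (1/2:ℝ) • (x + y) with hm
  have e : ∀ z, dk j a (x - z) * heatKernel (z - y) a =
    (fun w : V3 => heatKernel (x-y) (2*a) / (2*a) *
      (w j * heatKernel w (a/2) - (x j - y j)/2 * heatKernel w (a/2))) (z - m) := by
    intro z
    have := hk_mul h x y z
    rw [← hm] at this
    have hz : (z - m) j = z j - (1/2) * (x j + y j) := by simp [hm]; ring
    simp only [dk, Pi.sub_apply, hz]
    rw [mul_assoc, this]
    field_simp
    ring
  simp_rw [e]
  rw [integral_sub_right_eq_self (fun w : V3 => heatKernel (x-y) (2*a) / (2*a) *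
      (w j * heatKernel w (a/2) - (x j - y j)/2 * heatKernel w (a/2))), integral_const_mul,
      integral_sub (hk_ib1 h2 j) ((hk_ib0 h2).const_mul _), hk_int1 h2, integral_const_mul, hk_int0 h2]
  simp [dk]
  field_simp
  ring

/-- minus the time derivative of the heat kernel -/
def kap (τ : ℝ) (d : V3) : ℝ := heatKernel d τ * (3/(2*τ) - (∑ i, (d i)^2) / (4*τ^2))

lemma dd_comp1 {a : ℝ} (h : 0 < a) (j : Fin 3) (x y : V3) :
    ∫ z, dk j a (x - z) * dk j a (y - z) =
      heatKernel (x-y) (2*a) / (4*a^2) * (a - (x j - y j)^2/4) := by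
  have h2 : 0 < a / 2 := by positivity
  set m := (1/2:ℝ) • (x + y) with hm
  have e : ∀ z, dk j a (x - z) * dk j a (y - z) =
    (fun w : V3 => heatKernel (x-y) (2*a) / (4*a^2) *
      ((w j)^2 * heatKernel w (a/2) - (x j - y j)^2/4 * heatKernel w (a/2))) (z - m) := by
    intro z
    have := hk_mul h x y z
    rw [← hm, ← hk_neg (z - y), neg_sub] at this
    have hz : (z - m) j = z j - (1/2) * (x j + y j) := by simp [hm]; ring
    simp only [dk, Pi.sub_apply, hz]
    rw [mul_mul_mul_comm, this]
    field_simp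
    ring
  simp_rw [e]
  rw [integral_sub_right_eq_self (fun w : V3 => heatKernel (x-y) (2*a) / (4*a^2) *
      ((w j)^2 * heatKernel w (a/2) - (x j - y j)^2/4 * heatKernel w (a/2))), integral_const_mul,
      integral_sub (hk_ib2 h2 j) ((hk_ib0 h2).const_mul _), hk_int2 h2, integral_const_mul, hk_int0 h2]
  ring

lemma dd_comp {a : ℝ} (h : 0 < a) (x y : V3) :
    ∑ j, ∫ z, dk j a (x - z) * dk j a (y - z) = kap (2*a) (x - y) := by
  simp only [dd_comp1 h, kap, Fin.sum_univ_three, Pi.sub_apply]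
  field_simp
  ring

lemma hk_deriv (d : V3) {τ : ℝ} (h : 0 < τ) :
    HasDerivAt (fun t => heatKernel d t) (- kap τ d) τ := by
  have h1 : HasDerivAt (fun t : ℝ => 4 * π * t) (4*π) τ := by
    simpa using (hasDerivAt_id τ).const_mul (4*π)
  have h2 := h1.rpow_const (p := -(3:ℝ)/2) (Or.inl (by positivity))
  have h3 : HasDerivAt (fun t : ℝ => 4 * t) 4 τ := by
    simpa using (hasDerivAt_id τ).const_mul (4:ℝ)
  have h4 := ((hasDerivAt_const τ (-(∑ i, (d i)^2))).div h3 (by positivity)).exp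
  have h5 := h2.mul h4
  have h6 : HasDerivAt (fun t => (4 * π * t) ^ (-(3:ℝ)/2) * Real.exp (-(∑ i, (d i)^2) / (4 * t)))
      (- kap τ d) τ := by
    refine h5.congr_deriv ?_
    simp only [kap, hk_pos h]
    rw [Real.rpow_sub_one (by positivity)]
    simp only [Pi.div_apply]
    field_simp
    ring
  refine h6.congr_of_eventuallyEq ?_
  filter_upwards [lt_mem_nhds h] with t ht
  exact hk_pos ht d

lemma dk_cont {a : ℝ} (h : 0 < a) (j : Fin 3) : Continuous (dk j a) := by
  unfold dk
  have := hk_cont h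
  fun_prop

lemma dk_ib {a : ℝ} (h : 0 < a) (j : Fin 3) : Integrable (dk j a) := by
  refine ((hk_ib1 h j).const_mul (-1/(2*a))).congr (ae_of_all _ fun w => ?_)
  simp only [dk]; ring

lemma dk_bdd {a : ℝ} (h : 0 < a) (j : Fin 3) : ∃ C, ∀ w, |dk j a w| ≤ C := by
  refine ⟨(1 + 4*a)/(2*a) * (4 * π * a) ^ (-(3:ℝ)/2), fun w => ?_⟩
  have hS : (w j)^2 ≤ ∑ i, (w i)^2 :=
    Finset.single_le_sum (f := fun i => (w i)^2) (fun i _ => sq_nonneg _) (Finset.mem_univ j)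
  set S := ∑ i, (w i)^2 with hSd
  have e1 : |w j| ≤ (1+4*a) * Real.exp (S/(4*a)) := by
    have h1 := Real.add_one_le_exp (S/(4*a))
    have h2 : |w j| ≤ 1 + S := by nlinarith [sq_nonneg (|w j| - 1), sq_abs (w j), abs_nonneg (w j)]
    have h3 : 0 ≤ S / (4*a) := by positivity
    have h4 : S = 4*a*(S/(4*a)) := by field_simp
    nlinarith
  have e2 : Real.exp (-S/(4*a)) = (Real.exp (S/(4*a)))⁻¹ := by rw [← Real.exp_neg]; congr 1; ring
  rw [dk, abs_mul, abs_of_nonneg (hk_nonneg _ _), hk_pos h, ← hSd, e2, abs_div, abs_neg,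
    abs_of_pos (show 0 < 2*a by positivity)]
  have : |w j| * (Real.exp (S/(4*a)))⁻¹ ≤ 1 + 4*a := by
    rw [← div_eq_mul_inv, div_le_iff₀ (Real.exp_pos _)]; exact e1
  calc |w j| / (2*a) * ((4 * π * a) ^ (-(3:ℝ)/2) * (Real.exp (S/(4*a)))⁻¹)
      = (|w j| * (Real.exp (S/(4*a)))⁻¹) / (2*a) * (4 * π * a) ^ (-(3:ℝ)/2) := by ring
    _ ≤ _ := by gcongr

lemma dk_L1 {a : ℝ} (h : 0 < a) (j : Fin 3) : ∫ w, |dk j a w| ≤ 2 * a ^ (-(1:ℝ)/2) := by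
  have hs : 0 < √a := Real.sqrt_pos.2 h
  have hss : √a * √a = a := Real.mul_self_sqrt h.le
  have : ∫ w, |dk j a w| ≤ ∫ w : V3, (1/(2*a)) * (√a * heatKernel w a + (√a)⁻¹ * ((w j)^2 * heatKernel w a)) := by
    refine integral_mono (dk_ib h j).abs
      ((((hk_ib0 h).const_mul _).add ((hk_ib2 h j).const_mul _)).const_mul _) fun w => ?_
    simp only [dk]
    rw [abs_mul, abs_of_nonneg (hk_nonneg _ _), abs_div, abs_neg, abs_of_pos (show 0 < 2*a by positivity)]
    have : |w j| ≤ √a + (√a)⁻¹ * (w j)^2 := by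
      rw [← sub_nonneg]
      have : √a + (√a)⁻¹ * (w j)^2 - |w j| = (√a)⁻¹ * (a + (w j)^2 - √a * |w j|) := by
        field_simp
        rw [sq, hss]
      rw [this]
      apply mul_nonneg (by positivity)
      nlinarith [sq_nonneg (√a - |w j|), sq_abs (w j)]
    calc |w j| / (2*a) * heatKernel w a ≤ (√a + (√a)⁻¹ * (w j)^2) / (2*a) * heatKernel w a := by
          gcongr; exact hk_nonneg _ _
      _ = _ := by ring
  refine this.trans ?_
  rw [integral_const_mul, integral_add ((hk_ib0 h).const_mul _) ((hk_ib2 h j).const_mul _),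
    integral_const_mul, integral_const_mul, hk_int0 h, hk_int2 h]
  rw [show -(1:ℝ)/2 = -(1/2) by norm_num, Real.rpow_neg h.le, ← Real.sqrt_eq_rpow]
  have : (1 / (2 * a) * (√a * 1 + (√a)⁻¹ * (2 * a))) = 3/2 * (√a)⁻¹ := by
    field_simp; rw [sq, hss]; ring
  rw [this]
  have := inv_pos.2 hs
  linarith

lemma kap_bdd {ε τ : ℝ} (he : 0 < ε) (h : ε ≤ τ) (d : V3) :
    |kap τ d| ≤ (4*π*ε)^(-(3:ℝ)/2) * ((5/2)/ε) := by
  have ht : 0 < τ := he.trans_le h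
  set S := ∑ i, (d i)^2 with hSd
  have hS0 : 0 ≤ S := by positivity
  have e2 : Real.exp (-S/(4*τ)) = (Real.exp (S/(4*τ)))⁻¹ := by rw [← Real.exp_neg]; congr 1; ring
  have e3 : S/(4*τ) * (Real.exp (S/(4*τ)))⁻¹ ≤ 1 := by
    rw [← div_eq_mul_inv, div_le_one (Real.exp_pos _)]
    linarith [Real.add_one_le_exp (S/(4*τ))]
  have e4 : (Real.exp (S/(4*τ)))⁻¹ ≤ 1 := by
    apply inv_le_one_of_one_le₀; apply Real.one_le_exp; positivity
  rw [kap, abs_mul, abs_of_nonneg (hk_nonneg _ _), hk_pos ht, ← hSd, e2]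
  have e5 : |3/(2*τ) - S/(4*τ^2)| ≤ (3/2 + S/(4*τ))/τ := by
    have : (3/2 + S/(4*τ))/τ = 3/(2*τ) + S/(4*τ^2) := by field_simp
    rw [this]
    have h1 : 0 ≤ 3/(2*τ) := by positivity
    have h2 : 0 ≤ S/(4*τ^2) := by positivity
    rw [abs_le]; constructor <;> linarith
  calc _ ≤ (4 * π * τ) ^ (-(3:ℝ)/2) * (Real.exp (S/(4*τ)))⁻¹ * ((3/2 + S/(4*τ))/τ) := by gcongr
    _ = (4 * π * τ) ^ (-(3:ℝ)/2) * ((3/2 * (Real.exp (S/(4*τ)))⁻¹ + S/(4*τ) * (Real.exp (S/(4*τ)))⁻¹)/τ) := by ring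
    _ ≤ (4 * π * ε) ^ (-(3:ℝ)/2) * ((3/2 * 1 + 1)/ε) := by
      have := Real.rpow_le_rpow_of_nonpos (x := 4*π*ε) (y := 4*π*τ) (z := -(3:ℝ)/2) (by positivity)
        (by gcongr) (by norm_num)
      gcongr ?_ * ?_
      gcongr
    _ = _ := by norm_num

lemma kap_meas : Measurable (fun p : V3 × ℝ => kap p.2 p.1) := by
  unfold kap
  have := hk_meas
  fun_prop

lemma dk_meas (j : Fin 3) : Measurable (fun p : V3 × ℝ => dk j p.2 p.1) := by
  unfold dk
  have := hk_meas
  fun_prop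

/-- convolution -/
def cv (k φ : V3 → ℝ) (z : V3) : ℝ := ∫ y, k (z - y) * φ y

lemma cv_integrand {k φ : V3 → ℝ} (hk : Integrable k) (hφ : Integrable φ) :
    Integrable (fun p : V3 × V3 => k (p.1 - p.2) * φ p.2) (volume.prod volume) := by
  have := Integrable.convolution_integrand (ContinuousLinearMap.mul ℝ ℝ) hφ hk
  refine this.congr (ae_of_all _ fun p => ?_)
  simp [mul_comm]

lemma cv_ib {k φ : V3 → ℝ} (hk : Integrable k) (hφ : Integrable φ) : Integrable (cv k φ) :=
  (cv_integrand hk hφ).integral_prod_left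

lemma cv_bdd {k φ : V3 → ℝ} {K : ℝ} (hK : ∀ w, |k w| ≤ K) (hφ : Integrable φ) (z : V3) :
    |cv k φ z| ≤ K * ∫ y, |φ y| := by
  unfold cv
  rw [← integral_const_mul, ← Real.norm_eq_abs]
  refine norm_integral_le_of_norm_le (hφ.abs.const_mul K) (ae_of_all _ fun y => ?_)
  rw [Real.norm_eq_abs, abs_mul]
  gcongr
  exact hK _

lemma mul_ib_bdd {α : Type*} [MeasurableSpace α] {μ : Measure α} {f g : α → ℝ} {K : ℝ}
    (hf : Integrable f μ) (hg : AEStronglyMeasurable g μ) (hK : ∀ w, |g w| ≤ K) :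
    Integrable (fun x => g x * f x) μ :=
  hf.bdd_mul hg (ae_of_all _ hK)

lemma cv_sq_ib {k φ : V3 → ℝ} {K : ℝ} (hk : Integrable k) (hK : ∀ w, |k w| ≤ K) (hφ : Integrable φ) :
    Integrable (fun z => cv k φ z ^ 2) := by
  simp only [sq]
  exact mul_ib_bdd (cv_ib hk hφ) (cv_ib hk hφ).aestronglyMeasurable (cv_bdd hK hφ)

lemma cv_mul {k1 k2 φ ψ : V3 → ℝ} {K : ℝ} (h1 : Continuous k1) (hK : ∀ w, |k1 w| ≤ K)
    (h2 : Integrable k2) (hφ : Integrable φ) (hψ : Integrable ψ) :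
    ∫ z, cv k1 φ z * cv k2 ψ z =
      ∫ x, ∫ y, φ x * ψ y * ∫ z, k1 (z - x) * k2 (z - y) := by
  have a1 : ∀ z, cv k1 φ z * cv k2 ψ z = ∫ x, k1 (z - x) * (cv k2 ψ z * φ x) := by
    intro z
    unfold cv
    rw [← integral_mul_const]
    congr 1; ext x; ring
  simp_rw [a1]
  rw [integral_integral_swap]
  · congr 1; ext x
    have a2 : ∀ z, k1 (z - x) * (cv k2 ψ z * φ x) = φ x * ∫ y, k1 (z - x) * (k2 (z - y) * ψ y) := by
      intro z
      rw [integral_const_mul]; unfold cv; ring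
    simp_rw [a2]
    rw [integral_const_mul, integral_integral_swap]
    · rw [← integral_const_mul]
      congr 1; ext y
      rw [mul_assoc, ← integral_const_mul (ψ y)]
      congr 2; ext z; ring
    · refine mul_ib_bdd (cv_integrand h2 hψ) ?_ (K := K) (fun p => hK _)
      exact (h1.comp (continuous_fst.sub continuous_const)).aestronglyMeasurable
  · refine mul_ib_bdd ((cv_ib h2 hψ).mul_prod hφ) ?_ (K := K) (fun p => hK _)
    exact (h1.comp (continuous_fst.sub continuous_snd)).aestronglyMeasurable

lemma dk_neg (j : Fin 3) (a : ℝ) (w : V3) : dk j a (-w) = - dk j a w := by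
  simp [dk, hk_neg]; ring

lemma hk_abs_le {a : ℝ} (h : 0 < a) (w : V3) : |heatKernel w a| ≤ (4 * π * a) ^ (-(3:ℝ)/2) := by
  rw [abs_of_nonneg (hk_nonneg _ _)]; exact hk_le h w

lemma E1 {a : ℝ} (h : 0 < a) (j : Fin 3) {φ ψ : V3 → ℝ} (hφ : Integrable φ) (hψ : Integrable ψ) :
    ∫ x, φ x * cv (dk j (2*a)) ψ x = - ∫ z, cv (dk j a) φ z * cv (fun w => heatKernel w a) ψ z := by
  obtain ⟨K, hK⟩ := dk_bdd h j
  rw [cv_mul (dk_cont h j) hK (hk_ib0 h) hφ hψ, ← integral_neg]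
  congr 1; ext x
  rw [← integral_neg, cv, ← integral_const_mul]
  congr 1; ext y
  have : ∫ z, dk j a (z - x) * heatKernel (z - y) a = - dk j (2*a) (x - y) := by
    rw [← dk_comp h, ← integral_neg]
    congr 1; ext z
    rw [← neg_sub x z, dk_neg]; ring
  rw [this]; ring

lemma E3 {a : ℝ} (h : 0 < a) {ψ : V3 → ℝ} (hψ : Integrable ψ) :
    ∫ z, cv (fun w => heatKernel w a) ψ z ^ 2 = ∫ x, ∫ y, ψ x * ψ y * heatKernel (x - y) (2*a) := by
  simp only [sq]
  rw [cv_mul (hk_cont h) (hk_abs_le h) (hk_ib0 h) hψ hψ]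
  congr 1; ext x; congr 1; ext y
  rw [← hk_comp h]
  congr 2; ext z
  rw [← neg_sub x z, hk_neg]

lemma kap_ib2 {φ : V3 → ℝ} (hφ : Integrable φ) {τ : ℝ} (h : 0 < τ) :
    Integrable (fun p : V3 × V3 => φ p.1 * φ p.2 * kap τ (p.1 - p.2)) (volume.prod volume) := by
  have := mul_ib_bdd (hφ.mul_prod hφ) (g := fun p : V3 × V3 => kap τ (p.1 - p.2))
    (K := (4*π*τ)^(-(3:ℝ)/2) * ((5/2)/τ)) ?_ (fun p => kap_bdd h le_rfl _)
  · refine this.congr (ae_of_all _ fun p => ?_)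
    simp only []; ring
  · exact (kap_meas.comp (f := fun p : V3 × V3 => (p.1 - p.2, τ)) (by fun_prop)).aestronglyMeasurable

lemma hk_ib2' {φ ψ : V3 → ℝ} (hφ : Integrable φ) (hψ : Integrable ψ) {τ : ℝ} (h : 0 < τ) :
    Integrable (fun p : V3 × V3 => φ p.1 * ψ p.2 * heatKernel (p.1 - p.2) τ) (volume.prod volume) := by
  have := mul_ib_bdd (hφ.mul_prod hψ) (g := fun p : V3 × V3 => heatKernel (p.1 - p.2) τ)
    ?_ (fun p => hk_abs_le h _)
  · refine this.congr (ae_of_all _ fun p => ?_)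
    simp only []; ring
  · exact (hk_meas.comp (f := fun p : V3 × V3 => (p.1 - p.2, τ)) (by fun_prop)).aestronglyMeasurable

lemma E2a {a : ℝ} (h : 0 < a) (j : Fin 3) {φ : V3 → ℝ} (hφ : Integrable φ) :
    Integrable (fun p : V3 × V3 => φ p.1 * φ p.2 *
      (heatKernel (p.1-p.2) (2*a) / (4*a^2) * (a - (p.1 j - p.2 j)^2/4))) (volume.prod volume) := by
  obtain ⟨K, hK⟩ := dk_bdd h j
  have := mul_ib_bdd (hφ.mul_prod hφ) (g := fun p : V3 × V3 =>
      (heatKernel (p.1-p.2) (2*a) / (4*a^2) * (a - (p.1 j - p.2 j)^2/4)))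
    (K := K * ∫ w, |dk j a w|) ?_ ?_
  · refine this.congr (ae_of_all _ fun p => ?_)
    simp only []; ring
  · have := (hk_meas.comp (f := fun p : V3 × V3 => (p.1 - p.2, 2*a)) (by fun_prop))
    simp only [Function.comp_def] at this
    exact Measurable.aestronglyMeasurable (by fun_prop)
  · intro p
    rw [← dd_comp1 h, ← integral_sub_left_eq_self (fun w => |dk j a w|) volume p.2,
      ← integral_const_mul, ← Real.norm_eq_abs]
    refine norm_integral_le_of_norm_le (((dk_ib h j).abs.comp_sub_left p.2).const_mul K)
      (ae_of_all _ fun y => ?_)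
    rw [Real.norm_eq_abs, abs_mul]
    gcongr
    exact hK _

lemma E2 {a : ℝ} (h : 0 < a) {φ : V3 → ℝ} (hφ : Integrable φ) :
    ∑ j, ∫ z, cv (dk j a) φ z ^ 2 =
      ∫ p : V3 × V3, φ p.1 * φ p.2 * kap (2*a) (p.1 - p.2) ∂(volume.prod volume) := by
  have e : ∀ j, ∫ z, cv (dk j a) φ z ^ 2 = ∫ p : V3 × V3, φ p.1 * φ p.2 *
      (heatKernel (p.1-p.2) (2*a) / (4*a^2) * (a - (p.1 j - p.2 j)^2/4)) ∂(volume.prod volume) := by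
    intro j
    obtain ⟨K, hK⟩ := dk_bdd h j
    simp only [sq]
    rw [cv_mul (dk_cont h j) hK (dk_ib h j) hφ hφ]
    have := integral_prod _ (E2a h j hφ)
    simp only [sq] at this
    rw [this]
    congr 1; ext x; congr 1; ext y
    have := dd_comp1 h j x y
    simp only [sq] at this
    rw [← this]
    congr 2; ext z
    rw [← neg_sub x z, ← neg_sub y z, dk_neg, dk_neg]; ring
  simp_rw [e]
  rw [← integral_finsetSum _ (fun j _ => E2a h j hφ)]
  congr 1; ext p
  rw [← dd_comp h, ← Finset.mul_sum]
  simp only [dd_comp1 h]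

lemma kap_FTC (d : V3) {ε : ℝ} (he : 0 < ε) (h1 : ε ≤ 1) :
    ∫ τ in Ioc ε 1, kap τ d = heatKernel d ε - heatKernel d 1 := by
  have := intervalIntegral.integral_eq_sub_of_hasDerivAt (a := ε) (b := 1)
    (f := fun t => heatKernel d t) (f' := fun t => - kap t d) ?_ ?_
  · rw [← intervalIntegral.integral_of_le h1, ← neg_inj, ← intervalIntegral.integral_neg, this]
    ring
  · intro x hx
    rw [uIcc_of_le h1] at hx
    exact hk_deriv d (he.trans_le hx.1)
  · apply IntervalIntegrable.neg
    rw [intervalIntegrable_iff_integrableOn_Ioc_of_le h1]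
    refine Measure.integrableOn_of_bounded (M := (4*π*ε)^(-(3:ℝ)/2) * ((5/2)/ε)) (by simp) ?_ ?_
    · exact (kap_meas.comp (f := fun t : ℝ => (d, t)) (by fun_prop)).aestronglyMeasurable
    · filter_upwards [ae_restrict_mem measurableSet_Ioc] with t ht
      exact kap_bdd he ht.1.le _

lemma hk_quad_le {φ : V3 → ℝ} (hφ : Integrable φ) (hφ2 : Integrable (fun x => φ x ^ 2))
    {τ : ℝ} (h : 0 < τ) :
    ∫ p : V3 × V3, φ p.1 * φ p.2 * heatKernel (p.1 - p.2) τ ∂(volume.prod volume) ≤ ∫ x, φ x ^ 2 := by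
  have i1 : Integrable (fun p : V3 × V3 => heatKernel (p.1 - p.2) τ * φ p.2 ^2) (volume.prod volume) :=
    cv_integrand (hk_ib0 h) hφ2
  have i2 : Integrable (fun p : V3 × V3 => heatKernel (p.1 - p.2) τ * φ p.1 ^2) (volume.prod volume) := by
    refine i1.swap.congr (ae_of_all _ fun p => ?_)
    simp only [Function.comp, Prod.fst_swap, Prod.snd_swap]
    rw [← neg_sub, hk_neg]
  have v1 : ∫ p : V3 × V3, heatKernel (p.1 - p.2) τ * φ p.2 ^2 ∂(volume.prod volume) = ∫ x, φ x ^ 2 := by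
    rw [integral_prod_symm _ i1]
    congr 1; ext y
    simp only []
    rw [integral_mul_const, integral_sub_right_eq_self (fun w => heatKernel w τ), hk_int0 h, one_mul]
  have v2 : ∫ p : V3 × V3, heatKernel (p.1 - p.2) τ * φ p.1 ^2 ∂(volume.prod volume) = ∫ x, φ x ^ 2 := by
    rw [integral_prod _ i2]
    congr 1; ext y
    simp only []
    rw [integral_mul_const, integral_sub_left_eq_self (fun w => heatKernel w τ), hk_int0 h, one_mul]
  have : ∫ p : V3 × V3, φ p.1 * φ p.2 * heatKernel (p.1 - p.2) τ ∂(volume.prod volume) ≤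
     ∫ p : V3 × V3, (1/2) * (heatKernel (p.1 - p.2) τ * φ p.1 ^2 + heatKernel (p.1 - p.2) τ * φ p.2 ^2)
      ∂(volume.prod volume) := by
    refine integral_mono (hk_ib2' hφ hφ h) ((i2.add i1).const_mul _) fun p => ?_
    simp only []
    nlinarith [mul_nonneg (hk_nonneg (p.1-p.2) τ) (sq_nonneg (φ p.1 - φ p.2))]
  rw [integral_const_mul, integral_add i2 i1, v1, v2] at this
  linarith

lemma E4a {φ : V3 → ℝ} (hφ : Integrable φ) (hφ2 : Integrable (fun x => φ x ^ 2))
    {ε : ℝ} (he : 0 < ε) (h1 : ε ≤ 1) :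
    ∫⁻ τ in Ioc ε 1, ENNReal.ofReal (∑ j, ∫ z, cv (dk j (τ/2)) φ z ^ 2) ≤
      ENNReal.ofReal (∫ x, φ x ^ 2) := by
  have hI : Integrable (fun q : ℝ × (V3 × V3) => φ q.2.1 * φ q.2.2 * kap q.1 (q.2.1 - q.2.2))
      ((volume.restrict (Ioc ε 1)).prod (volume.prod volume)) := by
    have b : Integrable (fun q : ℝ × (V3 × V3) => (1:ℝ) * (φ q.2.1 * φ q.2.2))
       ((volume.restrict (Ioc ε 1)).prod (volume.prod volume)) :=
      Integrable.mul_prod (integrable_const (1:ℝ)) (hφ.mul_prod hφ)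
    refine (b.norm.const_mul ((4*π*ε)^(-(3:ℝ)/2) * ((5/2)/ε))).mono' ?_ ?_
    · refine AEStronglyMeasurable.mul (by simpa using b.aestronglyMeasurable) ?_
      exact (kap_meas.comp (f := fun q : ℝ × (V3 × V3) => (q.2.1 - q.2.2, q.1))
        (by fun_prop)).aestronglyMeasurable
    · have : ∀ᵐ q : ℝ × (V3 × V3) ∂((volume.restrict (Ioc ε 1)).prod (volume.prod volume)), q.1 ∈ Ioc ε 1 :=
        Measure.quasiMeasurePreserving_fst.ae (ae_restrict_mem measurableSet_Ioc)
      filter_upwards [this] with q hq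
      rw [norm_mul, one_mul, mul_comm]
      gcongr
      exact kap_bdd he hq.1.le _
  have e0 : ∀ τ ∈ Ioc ε 1, ENNReal.ofReal (∑ j, ∫ z, cv (dk j (τ/2)) φ z ^ 2) = ENNReal.ofReal
      (∫ p : V3 × V3, φ p.1 * φ p.2 * kap τ (p.1 - p.2) ∂(volume.prod volume)) := by
    intro τ hτ
    have : 0 < τ := he.trans hτ.1
    rw [E2 (by positivity) hφ]
    congr 2; ext p; congr 2; ring
  rw [setLIntegral_congr_fun measurableSet_Ioc e0, ← ofReal_integral_eq_lintegral_ofReal hI.integral_prod_left]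
  · apply ENNReal.ofReal_le_ofReal
    rw [integral_integral_swap hI]
    simp_rw [integral_const_mul, kap_FTC _ he h1, mul_sub]
    rw [integral_sub (hk_ib2' hφ hφ he) (hk_ib2' hφ hφ one_pos)]
    have a1 := hk_quad_le hφ hφ2 he
    have a2 : 0 ≤ ∫ p : V3 × V3, φ p.1 * φ p.2 * heatKernel (p.1 - p.2) 1 ∂(volume.prod volume) := by
      rw [integral_prod _ (hk_ib2' hφ hφ one_pos)]
      have := E3 (a := 1/2) (by norm_num) hφ
      norm_num at this
      simp only []
      rw [← this]
      positivity
    linarith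
  · filter_upwards [ae_restrict_mem measurableSet_Ioc] with τ hτ
    have : 0 < τ := he.trans hτ.1
    have e := E2 (a := τ/2) (by positivity) hφ
    rw [mul_div_cancel₀ _ (by norm_num)] at e
    simp only [Pi.zero_apply]
    rw [← e]
    positivity

lemma E4 {φ : V3 → ℝ} (hφ : Integrable φ) (hφ2 : Integrable (fun x => φ x ^ 2)) :
    ∫⁻ τ in Ioc 0 1, ENNReal.ofReal (∑ j, ∫ z, cv (dk j (τ/2)) φ z ^ 2) ≤
      ENNReal.ofReal (∫ x, φ x ^ 2) := by
  have : Ioc (0:ℝ) 1 = ⋃ n : ℕ, Ioc (1/((n:ℝ)+1)) 1 := by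
    ext x
    simp only [mem_Ioc, mem_iUnion]
    constructor
    · rintro ⟨h0, h1⟩
      obtain ⟨n, hn⟩ := exists_nat_one_div_lt h0
      exact ⟨n, hn, h1⟩
    · rintro ⟨n, hn, h1⟩
      exact ⟨lt_trans (by positivity) hn, h1⟩
  rw [this, setLIntegral_iUnion_of_directed]
  · refine iSup_le fun n => E4a hφ hφ2 (by positivity) ?_
    rw [div_le_one (by positivity)]; simp
  · apply Monotone.directed_le
    intro m n hmn
    apply Ioc_subset_Ioc_left
    gcongr

/-- heat kernel, extended nonnegative -/
def hkE (w : V3) (τ : ℝ) : ℝ≥0∞ := ENNReal.ofReal (heatKernel w τ)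

lemma hkE_meas : Measurable (fun p : V3 × ℝ => hkE p.1 p.2) := hk_meas.ennreal_ofReal

lemma hkE_meas' {τ : ℝ} : Measurable (fun w => hkE w τ) :=
  hkE_meas.comp (f := fun w : V3 => (w, τ)) (by fun_prop)

lemma hkE_int {τ : ℝ} (h : 0 < τ) : ∫⁻ w, hkE w τ = 1 := by
  unfold hkE
  rw [← ofReal_integral_eq_lintegral_ofReal (hk_ib0 h) (ae_of_all _ fun w => hk_nonneg w τ), hk_int0 h]
  simp

lemma hkE_int' {τ : ℝ} (h : 0 < τ) (x : V3) : ∫⁻ y, hkE (x - y) τ = 1 := by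
  rw [lintegral_sub_left_eq_self (fun w => hkE w τ), hkE_int h]

lemma J1 {τ : ℝ} (h : 0 < τ) (f : V3 → ℝ≥0∞) (x : V3) (b : ℝ≥0∞) (hb : ∀ y, f y ≤ b) :
    ∫⁻ y, f y * hkE (x - y) τ ≤ b := by
  calc _ ≤ ∫⁻ y, b * hkE (x - y) τ := by gcongr; exact hb _
    _ = b := by
      have hm : Measurable (fun y => hkE (x - y) τ) := hkE_meas'.comp (by fun_prop)
      rw [lintegral_const_mul _ hm, hkE_int' h, mul_one]

lemma J2 {τ : ℝ} (h : 0 < τ) {f : V3 → ℝ≥0∞} (hf : Measurable f) (x : V3) :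
    ∫⁻ y, f y * hkE (x - y) τ ≤
      (∫⁻ y, f y ^ (6/5:ℝ)) ^ (5/6:ℝ) * ENNReal.ofReal ((4 * π * τ) ^ (-(5:ℝ)/4)) := by
  have hm : Measurable (fun y => hkE (x - y) τ) := hkE_meas'.comp (by fun_prop)
  have hpq : (6/5:ℝ).HolderConjugate 6 := by
    rw [Real.holderConjugate_iff]; norm_num
  have := ENNReal.lintegral_mul_le_Lp_mul_Lq volume hpq hf.aemeasurable hm.aemeasurable
  refine this.trans ?_
  rw [show (1 / (6/5:ℝ)) = 5/6 by norm_num]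
  gcongr
  have hS : ∀ y, hkE (x - y) τ ^ (6:ℝ) ≤ ENNReal.ofReal ((4*π*τ)^(-(3:ℝ)/2)) ^ (5:ℝ) * hkE (x-y) τ := by
    intro y
    have h1 : hkE (x-y) τ ≤ ENNReal.ofReal ((4*π*τ)^(-(3:ℝ)/2)) := ENNReal.ofReal_le_ofReal (hk_le h _)
    rw [show (6:ℝ) = 5 + 1 by norm_num, ENNReal.rpow_add_of_nonneg _ _ (by norm_num) (by norm_num),
      ENNReal.rpow_one]
    gcongr
  calc (∫⁻ y, hkE (x - y) τ ^ (6:ℝ)) ^ (1/6:ℝ)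
      ≤ (∫⁻ y, ENNReal.ofReal ((4*π*τ)^(-(3:ℝ)/2)) ^ (5:ℝ) * hkE (x-y) τ) ^ (1/6:ℝ) := by
        gcongr with y; exact hS y
    _ = _ := by
      rw [lintegral_const_mul _ hm, hkE_int' h, mul_one, ← ENNReal.rpow_mul,
        ENNReal.ofReal_rpow_of_nonneg (by positivity) (by norm_num), ← Real.rpow_mul (by positivity)]
      norm_num

/-- the time integral -/
lemma tail_int {T : ℝ} (hT : 0 < T) :
    ∫⁻ τ in Ioi T, ENNReal.ofReal ((4 * π * τ) ^ (-(5:ℝ)/4)) ≤ ENNReal.ofReal (4 * T ^ (-(1:ℝ)/4)) := by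
  have i := integrableOn_Ioi_rpow_of_lt (a := -(5:ℝ)/4) (by norm_num) hT
  calc _ ≤ ∫⁻ τ in Ioi T, ENNReal.ofReal (τ ^ (-(5:ℝ)/4)) := by
        refine setLIntegral_mono' measurableSet_Ioi fun τ hτ => ?_
        have : 0 < τ := hT.trans hτ
        apply ENNReal.ofReal_le_ofReal
        apply Real.rpow_le_rpow_of_nonpos this _ (by norm_num)
        nlinarith [Real.pi_gt_three]
    _ = ENNReal.ofReal (∫ τ in Ioi T, τ ^ (-(5:ℝ)/4)) := by
        rw [ofReal_integral_eq_lintegral_ofReal i]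
        filter_upwards [ae_restrict_mem measurableSet_Ioi] with τ hτ
        have : 0 < τ := hT.trans hτ
        simp only [Pi.zero_apply]
        positivity
    _ ≤ _ := by
        rw [integral_Ioi_rpow_of_lt (by norm_num) hT]
        apply ENNReal.ofReal_le_ofReal
        norm_num
        linarith

lemma J3 {b M T : ℝ} (hb : 0 < b) (hM : 0 < M) (hT : T = M ^ (2/3:ℝ) * b ^ (-(4:ℝ)/5)) :
    b * T + M ^ (5/6:ℝ) * (4 * T ^ (-(1:ℝ)/4)) = 5 * (M ^ (2/3:ℝ) * b ^ (1/5:ℝ)) := by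
  have e1 : b * T = M ^ (2/3:ℝ) * b ^ (1/5:ℝ) := by
    rw [hT, mul_left_comm]
    congr 1
    nth_rewrite 1 [← Real.rpow_one b]
    rw [← Real.rpow_add hb]; norm_num
  have e2 : T ^ (-(1:ℝ)/4) = M ^ (-(1/6):ℝ) * b ^ (1/5:ℝ) := by
    rw [hT, Real.mul_rpow (by positivity) (by positivity), ← Real.rpow_mul hM.le, ← Real.rpow_mul hb.le]
    norm_num
  have e3 : M ^ (5/6:ℝ) * M ^ (-(1/6):ℝ) = M ^ (2/3:ℝ) := by
    rw [← Real.rpow_add hM]; norm_num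
  rw [e1, e2]
  linear_combination 4 * b ^ (1/5:ℝ) * e3

lemma hkE_nonpos {τ : ℝ} (h : τ ≤ 0) (w : V3) : hkE w τ = 0 := by
  simp [hkE, heatKernel, not_lt.2 h]

/-- potential estimate for truncated function -/
lemma J4 {f : V3 → ℝ≥0∞} (hf : Measurable f) (x : V3) {b : ℝ≥0∞} (hb : ∀ y, f y ≤ b) (hbt : b ≠ ⊤)
    {M : ℝ≥0∞} (hM : ∫⁻ y, f y ^ (6/5:ℝ) ≤ M) (hM0 : M ≠ 0) (hMt : M ≠ ⊤) :
    ∫⁻ τ, ∫⁻ y, f y * hkE (x - y) τ ≤ 5 * (M ^ (2/3:ℝ) * b ^ (1/5:ℝ)) := by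
  rcases eq_or_ne b 0 with h0 | h0
  · have : ∀ y, f y = 0 := fun y => le_antisymm (h0 ▸ hb y) bot_le
    simp [this]
  lift b to NNReal using hbt
  lift M to NNReal using hMt
  have hb0 : (0:ℝ) < b := by
    have : b ≠ 0 := by simpa using h0
    positivity
  have hM0' : (0:ℝ) < M := by
    have : M ≠ 0 := by simpa using hM0
    positivity
  set T : ℝ := (M:ℝ) ^ (2/3:ℝ) * (b:ℝ) ^ (-(4:ℝ)/5) with hT
  have hTp : 0 < T := by positivity
  have hz : ∫⁻ τ, ∫⁻ y, f y * hkE (x - y) τ = ∫⁻ τ in Ioi 0, ∫⁻ y, f y * hkE (x - y) τ := by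
    rw [← lintegral_indicator measurableSet_Ioi]
    congr 1; ext τ
    by_cases h : 0 < τ
    · simp [h]
    · simp [h, hkE_nonpos (not_lt.1 h)]
  rw [hz, ← Ioc_union_Ioi_eq_Ioi hTp.le]
  refine (lintegral_union_le _ _ _).trans ?_
  have a1 : ∫⁻ τ in Ioc 0 T, ∫⁻ y, f y * hkE (x - y) τ ≤ ENNReal.ofReal (b * T) := by
    calc _ ≤ ∫⁻ τ in Ioc 0 T, (b:ℝ≥0∞) := setLIntegral_mono' measurableSet_Ioc fun τ hτ => J1 hτ.1 f x b hb
      _ = _ := by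
        rw [setLIntegral_const, Real.volume_Ioc, sub_zero, ENNReal.ofReal_mul hb0.le]; simp
  have a2 : ∫⁻ τ in Ioi T, ∫⁻ y, f y * hkE (x - y) τ ≤
      ENNReal.ofReal ((M:ℝ) ^ (5/6:ℝ) * (4 * T ^ (-(1:ℝ)/4))) := by
    calc _ ≤ ∫⁻ τ in Ioi T, (M:ℝ≥0∞) ^ (5/6:ℝ) * ENNReal.ofReal ((4 * π * τ) ^ (-(5:ℝ)/4)) := by
          refine setLIntegral_mono' measurableSet_Ioi fun τ hτ => (J2 (hTp.trans hτ) hf x).trans ?_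
          gcongr
      _ ≤ (M:ℝ≥0∞) ^ (5/6:ℝ) * ENNReal.ofReal (4 * T ^ (-(1:ℝ)/4)) := by
          rw [lintegral_const_mul _ (by fun_prop)]
          gcongr
          exact tail_int hTp
      _ = _ := by
          rw [ENNReal.ofReal_mul (p := (M:ℝ) ^ (5/6:ℝ)) (by positivity),
            ← ENNReal.ofReal_rpow_of_nonneg (x := (M:ℝ)) (p := 5/6) (by positivity) (by norm_num),
            ENNReal.ofReal_coe_nnreal]
  refine (add_le_add a1 a2).trans ?_
  rw [← ENNReal.ofReal_add (by positivity) (by positivity), J3 hb0 hM0' hT]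
  rw [ENNReal.ofReal_mul (by norm_num), ENNReal.ofReal_mul (by positivity),
    ← ENNReal.ofReal_rpow_of_nonneg (by positivity) (by norm_num),
    ← ENNReal.ofReal_rpow_of_nonneg (by positivity) (by norm_num)]
  simp

lemma HLS {g : V3 → ℝ≥0∞} (hg : Measurable g) (hgt : ∀ y, g y ≠ ⊤)
    (hMt : ∫⁻ y, g y ^ (6/5:ℝ) ≠ ⊤) :
    ∫⁻ τ, ∫⁻ x, ∫⁻ y, g x * g y * hkE (x - y) τ ≤ 10 * (∫⁻ y, g y ^ (6/5:ℝ)) ^ (5/3:ℝ) := by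
  set M := ∫⁻ y, g y ^ (6/5:ℝ) with hM
  rcases eq_or_ne M 0 with h0 | h0
  · have : g =ᵐ[volume] 0 := by
      rw [hM, lintegral_eq_zero_iff (by fun_prop)] at h0
      filter_upwards [h0] with y hy
      simp only [Pi.zero_apply, ENNReal.rpow_eq_zero_iff] at hy ⊢
      rcases hy with hy | hy
      · exact hy.1
      · exact absurd hy.2 (by norm_num)
    have : ∀ τ x, ∫⁻ y, g x * g y * hkE (x - y) τ = 0 := by
      intro τ x
      rw [← lintegral_zero (μ := (volume : Measure V3))]
      apply lintegral_congr_ae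
      filter_upwards [this] with y hy
      simp [hy]
    simp [this]
  have hkm : Measurable (fun q : ℝ × (V3 × V3) => hkE (q.2.1 - q.2.2) q.1) :=
    hkE_meas.comp (f := fun q : ℝ × (V3 × V3) => (q.2.1 - q.2.2, q.1)) (by fun_prop)
  have mF : Measurable (fun q : ℝ × (V3 × V3) => g q.2.1 * (min (g q.2.2) (g q.2.1) * hkE (q.2.1 - q.2.2) q.1)) := by
    fun_prop
  have mF1 : ∀ τ, Measurable (fun q : V3 × V3 => g q.1 * (min (g q.2) (g q.1) * hkE (q.1 - q.2) τ)) :=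
    fun τ => mF.comp (f := fun q : V3 × V3 => (τ, q)) (by fun_prop)
  have s1 : ∀ τ, ∫⁻ x, ∫⁻ y, g x * g y * hkE (x - y) τ ≤
      2 * ∫⁻ x, ∫⁻ y, g x * (min (g y) (g x) * hkE (x - y) τ) := by
    intro τ
    have sw : ∫⁻ x, ∫⁻ y, g y * (min (g x) (g y) * hkE (x - y) τ) =
        ∫⁻ x, ∫⁻ y, g x * (min (g y) (g x) * hkE (x - y) τ) := by
      rw [lintegral_lintegral_swap]
      · congr 1; ext x; congr 1; ext y
        rw [hkE, ← neg_sub, hk_neg, ← hkE]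
      · have := ((mF1 τ).comp measurable_swap).aemeasurable (μ := volume.prod volume)
        refine this.congr (ae_of_all _ fun q => ?_)
        simp only [Function.comp, Prod.fst_swap, Prod.snd_swap, Function.uncurry]
        rw [hkE, ← neg_sub, hk_neg, ← hkE]
    calc _ ≤ ∫⁻ x, ∫⁻ y, (g x * (min (g y) (g x) * hkE (x - y) τ) + g y * (min (g x) (g y) * hkE (x - y) τ)) := by
          gcongr with x y
          rcases le_total (g x) (g y) with h | h
          · rw [min_eq_right h, min_eq_left h]
            exact le_add_left (by rw [← mul_assoc, mul_comm (g x)])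
          · rw [min_eq_left h, min_eq_right h]
            exact le_add_right (by rw [← mul_assoc])
      _ = _ := by
          have m2 : ∀ x, Measurable (fun y => g x * (min (g y) (g x) * hkE (x - y) τ)) :=
            fun x => (mF1 τ).comp (f := fun y => (x, y)) (by fun_prop)
          have e2 := fun x => lintegral_add_left (μ := volume) (m2 x) (fun y => g y * (min (g x) (g y) * hkE (x - y) τ))
          rw [lintegral_congr e2]
          rw [lintegral_add_left (mF1 τ).lintegral_prod_right', sw, two_mul]
  calc _ ≤ ∫⁻ τ, 2 * ∫⁻ x, ∫⁻ y, g x * (min (g y) (g x) * hkE (x - y) τ) := lintegral_mono s1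
    _ = 2 * ∫⁻ τ, ∫⁻ x, ∫⁻ y, g x * (min (g y) (g x) * hkE (x - y) τ) :=
        lintegral_const_mul' _ _ (by simp)
    _ = 2 * ∫⁻ x, ∫⁻ τ, ∫⁻ y, g x * (min (g y) (g x) * hkE (x - y) τ) := by
        rw [lintegral_lintegral_swap]
        refine Measurable.aemeasurable ?_
        refine Measurable.lintegral_prod_right' (f := fun q : (ℝ × V3) × V3 => 
          g q.1.2 * (min (g q.2) (g q.1.2) * hkE (q.1.2 - q.2) q.1.1)) ?_
        exact mF.comp (f := fun q : (ℝ × V3) × V3 => (q.1.1, (q.1.2, q.2))) (by fun_prop)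
    _ ≤ 2 * ∫⁻ x, 5 * M ^ (2/3:ℝ) * g x ^ (6/5:ℝ) := by
        gcongr with x
        have : ∀ τ, ∫⁻ y, g x * (min (g y) (g x) * hkE (x - y) τ) =
            g x * ∫⁻ y, (min (g y) (g x) * hkE (x - y) τ) := fun τ => lintegral_const_mul' _ _ (hgt x)
        simp_rw [this]
        rw [lintegral_const_mul' _ _ (hgt x)]
        calc _ ≤ g x * (5 * (M ^ (2/3:ℝ) * g x ^ (1/5:ℝ))) := by
              gcongr
              refine J4 (by fun_prop) x (fun y => min_le_right _ _) (hgt x) ?_ h0 hMt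
              rw [hM]
              gcongr
              exact min_le_left _ _
          _ = _ := by
              rw [show (6/5:ℝ) = 1 + 1/5 by norm_num, ENNReal.rpow_add_of_nonneg _ _ (by norm_num) (by norm_num),
                ENNReal.rpow_one]
              ring
    _ = _ := by
        rw [lintegral_const_mul _ (by fun_prop), ← hM, show (5/3:ℝ) = 2/3 + 1 by norm_num,
          ENNReal.rpow_add_of_nonneg _ _ (by norm_num) (by norm_num), ENNReal.rpow_one]
        ring

lemma ofReal_integral_le {α : Type*} [MeasurableSpace α] {μ : Measure α} (f : α → ℝ) :
    ENNReal.ofReal (∫ x, f x ∂μ) ≤ ∫⁻ x, ENNReal.ofReal (f x) ∂μ := by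
  by_cases hf : Integrable f μ
  · calc _ ≤ ENNReal.ofReal (∫ x, max (f x) 0 ∂μ) := by
          apply ENNReal.ofReal_le_ofReal
          exact integral_mono hf hf.pos_part fun x => le_max_left _ _
      _ = ∫⁻ x, ENNReal.ofReal (max (f x) 0) ∂μ :=
          ofReal_integral_eq_lintegral_ofReal hf.pos_part (ae_of_all _ fun x => le_max_right _ _)
      _ = _ := by simp [ENNReal.ofReal_max]
  · simp [integral_undef hf]

lemma w_ib (t : ℝ) : IntegrableOn (fun s => (t - s) ^ (-(1:ℝ)/2)) (Ioo (-1) t) := by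
  rcases le_total t (-1) with h | h
  · simp [Ioo_eq_empty_of_le h]
  have h1 : IntervalIntegrable (fun x : ℝ => x ^ (-(1:ℝ)/2)) volume 0 (t+1) :=
    intervalIntegral.intervalIntegrable_rpow' (by norm_num)
  have h2 := h1.comp_sub_left t
  rw [← integrableOn_Ioc_iff_integrableOn_Ioo, ← intervalIntegrable_iff_integrableOn_Ioc_of_le h]
  have := h2.symm
  convert this using 1 <;> simp

lemma Bfull_meas (r : ℝ) : MeasurableSet (Bfull r) := by
  unfold Bfull euclNorm
  exact measurableSet_lt (by fun_prop) measurable_const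

lemma Bfull_fin : volume (Bfull 1) < ⊤ := by
  refine lt_of_le_of_lt (measure_mono ?_) (measure_closedBall_lt_top (x := (0:V3)) (r := 1))
  intro x hx
  rw [mem_closedBall_zero_iff, pi_norm_le_iff_of_nonneg zero_le_one]
  intro i
  have hx' : √(∑ i, (x i)^2) < 1 := hx
  rw [Real.sqrt_lt' one_pos] at hx'
  have hS : (x i)^2 ≤ ∑ i, (x i)^2 :=
    Finset.single_le_sum (f := fun i => (x i)^2) (fun i _ => sq_nonneg _) (Finset.mem_univ i)
  rw [Real.norm_eq_abs]
  exact (abs_le_one_iff_mul_self_le_one.2 (by nlinarith))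

/-- quadratic heat form in extended nonnegative reals -/
def WE (g : V3 → ℝ≥0∞) (τ : ℝ) : ℝ≥0∞ := ∫⁻ x, ∫⁻ y, g x * g y * hkE (x - y) τ

/-- inner potential -/
def FF (g : V3 → ℝ → ℝ) (j : Fin 3) (t : ℝ) (x : V3) (s : ℝ) : ℝ :=
  cv (dk j (t - s)) (fun y => g y s) x

lemma FF_meas {g : V3 → ℝ → ℝ} (hg : Measurable (fun p : V3 × ℝ => g p.1 p.2)) (j : Fin 3) (t : ℝ) :
    StronglyMeasurable (fun p : V3 × ℝ => FF g j t p.1 p.2) := by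
  unfold FF cv
  refine StronglyMeasurable.integral_prod_right' (f := fun q : (V3 × ℝ) × V3 =>
    dk j (t - q.1.2) (q.1.1 - q.2) * g q.2 q.1.2) ?_
  refine Measurable.stronglyMeasurable (Measurable.mul ?_ ?_)
  · exact (dk_meas j).comp (f := fun q : (V3 × ℝ) × V3 => (q.1.1 - q.2, t - q.1.2)) (by fun_prop)
  · exact hg.comp (f := fun q : (V3 × ℝ) × V3 => (q.2, q.1.2)) (by fun_prop)

lemma FF_bdd {g : V3 → ℝ → ℝ} {K : ℝ} (hK : ∀ y s, |g y s| ≤ K) (j : Fin 3) {t s : ℝ} (h : s < t) (x : V3) :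
    |FF g j t x s| ≤ 2 * K * (t - s) ^ (-(1:ℝ)/2) := by
  have hts : 0 < t - s := sub_pos.2 h
  have hK0 : 0 ≤ K := (abs_nonneg _).trans (hK 0 0)
  calc |FF g j t x s| ≤ ∫ y, K * |dk j (t-s) (x - y)| := by
        unfold FF cv
        rw [← Real.norm_eq_abs]
        refine norm_integral_le_of_norm_le (((dk_ib hts j).abs.comp_sub_left x).const_mul K)
          (ae_of_all _ fun y => ?_)
        rw [Real.norm_eq_abs, abs_mul, mul_comm]
        gcongr
        exact hK _ _
    _ = K * ∫ w, |dk j (t-s) w| := by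
        rw [integral_const_mul, integral_sub_left_eq_self (fun w => |dk j (t-s) w|)]
    _ ≤ K * (2 * (t-s) ^ (-(1:ℝ)/2)) := by gcongr; exact dk_L1 hts j
    _ = _ := by ring

/-- one component -/
def uu (g : Fin 3 → V3 → ℝ → ℝ) (t : ℝ) (x : V3) : ℝ := -∑ j, ∫ s in Ioo (-1:ℝ) t, FF (g j) j t x s

lemma uu_meas {g : Fin 3 → V3 → ℝ → ℝ} (hg : ∀ j, Measurable (fun p : V3 × ℝ => g j p.1 p.2)) (t : ℝ) :
    Measurable (uu g t) := by
  unfold uu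
  refine (Finset.measurable_fun_sum _ fun j _ => ?_).neg
  exact (StronglyMeasurable.integral_prod_right' (ν := volume.restrict (Ioo (-1:ℝ) t))
    (f := fun p : V3 × ℝ => FF (g j) j t p.1 p.2) (FF_meas (hg j) j t)).measurable

lemma uu_bdd {g : Fin 3 → V3 → ℝ → ℝ} {K : ℝ} (hK : ∀ j y s, |g j y s| ≤ K) (t : ℝ) :
    ∃ C, ∀ x, |uu g t x| ≤ C := by
  refine ⟨∑ j : Fin 3, ∫ s in Ioo (-1:ℝ) t, 2 * K * (t - s) ^ (-(1:ℝ)/2), fun x => ?_⟩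
  unfold uu
  rw [abs_neg]
  refine (Finset.abs_sum_le_sum_abs _ _).trans (Finset.sum_le_sum fun j _ => ?_)
  rw [← Real.norm_eq_abs]
  refine norm_integral_le_of_norm_le ((w_ib t).const_mul (2*K)) ?_
  filter_upwards [ae_restrict_mem measurableSet_Ioo] with s hs
  exact FF_bdd (hK j) j hs.2 x

lemma WE_meas {g : V3 → ℝ → ℝ≥0∞} (hg : Measurable (fun p : V3 × ℝ => g p.1 p.2)) :
    Measurable (fun p : ℝ × ℝ => WE (fun y => g y p.1) p.2) := by
  unfold WE
  refine Measurable.lintegral_prod_right' (f := fun q : (ℝ × ℝ) × V3 =>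
    ∫⁻ y, g q.2 q.1.1 * g y q.1.1 * hkE (q.2 - y) q.1.2) ?_
  refine Measurable.lintegral_prod_right' (f := fun q : ((ℝ × ℝ) × V3) × V3 =>
    g q.1.2 q.1.1.1 * g q.2 q.1.1.1 * hkE (q.1.2 - q.2) q.1.1.2) ?_
  refine (Measurable.mul ?_ ?_).mul ?_
  · exact hg.comp (f := fun q : ((ℝ × ℝ) × V3) × V3 => (q.1.2, q.1.1.1)) (by fun_prop)
  · exact hg.comp (f := fun q : ((ℝ × ℝ) × V3) × V3 => (q.2, q.1.1.1)) (by fun_prop)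
  · exact hkE_meas.comp (f := fun q : ((ℝ × ℝ) × V3) × V3 => (q.1.2 - q.2, q.1.1.2)) (by fun_prop)

lemma Q_le_WE {a : ℝ} (h : 0 < a) {ψ : V3 → ℝ} (hψ : Integrable ψ) :
    ENNReal.ofReal (∫ z, cv (fun w => heatKernel w a) ψ z ^ 2) ≤ WE (fun y => ‖ψ y‖ₑ) (2*a) := by
  rw [E3 h hψ]
  refine (ofReal_integral_le _).trans ?_
  unfold WE
  gcongr with x
  refine (ofReal_integral_le _).trans ?_
  gcongr with y
  unfold hkE
  rw [← enorm_mul, Real.enorm_eq_ofReal_abs, ← ENNReal.ofReal_mul (abs_nonneg _)]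
  apply ENNReal.ofReal_le_ofReal
  gcongr
  · exact hk_nonneg _ _
  · exact le_abs_self _

lemma S1 {g : Fin 3 → V3 → ℝ → ℝ} (hg : ∀ j, Measurable (fun p : V3 × ℝ => g j p.1 p.2))
    {K : ℝ} (hK : ∀ j y s, |g j y s| ≤ K) (hi : ∀ j s, Integrable (fun y => g j y s))
    {t : ℝ} (ht0 : t < 0) :
    ENNReal.ofReal (∫ x in Bfull 1, uu g t x ^ 2) ≤
      ∫⁻ s in Ioo (-1:ℝ) t, ∑ j, WE (fun y => ‖g j y s‖ₑ) (t - s) := by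
  obtain ⟨C, hC⟩ := uu_bdd hK t
  have hum := uu_meas hg t
  haveI : IsFiniteMeasure (volume.restrict (Bfull 1)) := ⟨by simpa using Bfull_fin⟩
  set φ : V3 → ℝ := (Bfull 1).indicator (uu g t) with hφd
  have hφ : Integrable φ := by
    rw [hφd, integrable_indicator_iff (Bfull_meas 1)]
    exact Integrable.of_bound hum.aestronglyMeasurable C (ae_of_all _ hC)
  have hφC : ∀ x, |φ x| ≤ C := by
    intro x
    by_cases hx : x ∈ Bfull 1
    · simp [hφd, hx, hC]
    · simp [hφd, hx, (abs_nonneg _).trans (hC x)]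
  have hφ2 : Integrable (fun x => φ x ^ 2) := by
    simp only [sq]
    exact mul_ib_bdd hφ hφ.aestronglyMeasurable hφC
  have hN : ∫ x in Bfull 1, uu g t x ^ 2 = ∫ x, φ x ^ 2 := by
    rw [← integral_indicator (Bfull_meas 1)]
    congr 1; ext x
    by_cases hx : x ∈ Bfull 1 <;> simp [hφd, hx]
  have hN' : ∫ x, φ x ^ 2 = ∫ x, φ x * uu g t x := by
    congr 1; ext x
    by_cases hx : x ∈ Bfull 1 <;> simp [hφd, hx, sq]
  have hFint : ∀ j, Integrable (fun p : V3 × ℝ => φ p.1 * FF (g j) j t p.1 p.2)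
      (volume.prod (volume.restrict (Ioo (-1:ℝ) t))) := by
    intro j
    have b := hφ.abs.mul_prod ((w_ib t).const_mul (2*K))
    refine b.mono' (hφ.aestronglyMeasurable.comp_fst.mul (FF_meas (hg j) j t).aestronglyMeasurable) ?_
    have : ∀ᵐ q : V3 × ℝ ∂(volume.prod (volume.restrict (Ioo (-1:ℝ) t))), q.2 ∈ Ioo (-1:ℝ) t :=
        Measure.quasiMeasurePreserving_snd.ae (ae_restrict_mem measurableSet_Ioo)
    filter_upwards [this] with q hq
    rw [norm_mul]
    gcongr
    · exact le_rfl
    · exact FF_bdd (hK j) j hq.2 _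
  have hN2 : ∫ x, φ x ^ 2 = ∫ s in Ioo (-1:ℝ) t, -∑ j, ∫ x, φ x * FF (g j) j t x s := by
    rw [hN', integral_neg, integral_finsetSum _ (fun j _ => (hFint j).integral_prod_right)]
    have : ∀ x, φ x * uu g t x = -∑ j, ∫ s in Ioo (-1:ℝ) t, φ x * FF (g j) j t x s := by
      intro x
      unfold uu
      simp only [integral_const_mul, ← Finset.mul_sum]
      ring
    simp_rw [this]
    rw [integral_neg, integral_finsetSum _ (fun j _ => (hFint j).integral_prod_left)]
    congr 1
    refine Finset.sum_congr rfl fun j _ => ?_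
    exact integral_integral_swap (hFint j)
  set p : ℝ → ℝ≥0∞ := fun τ => ENNReal.ofReal (∑ j, ∫ z, cv (dk j (τ/2)) φ z ^ 2) with hp
  have hpt : ∀ s ∈ Ioo (-1:ℝ) t, ENNReal.ofReal (-∑ j, ∫ x, φ x * FF (g j) j t x s) ≤
      (1/2) * p (t - s) + (1/2) * ∑ j, WE (fun y => ‖g j y s‖ₑ) (t - s) := by
    intro s hs
    have hts : 0 < t - s := sub_pos.2 hs.2
    have ha : 0 < (t - s)/2 := by positivity
    have h2 : 2 * ((t-s)/2) = t - s := by ring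
    have e : ∀ j, - ∫ x, φ x * FF (g j) j t x s ≤
        (1/2) * (∫ z, cv (dk j ((t-s)/2)) φ z ^ 2) +
        (1/2) * (∫ z, cv (fun w => heatKernel w ((t-s)/2)) (fun y => g j y s) z ^ 2) := by
      intro j
      have e1 := E1 ha j hφ (hi j s)
      rw [h2] at e1
      unfold FF
      rw [e1, neg_neg]
      obtain ⟨L, hL⟩ := dk_bdd ha j
      have i1 := cv_sq_ib (dk_ib ha j) hL hφ
      have i2 := cv_sq_ib (hk_ib0 ha) (hk_abs_le ha) (hi j s)
      rw [← integral_const_mul, ← integral_const_mul, ← integral_add (i1.const_mul _) (i2.const_mul _)]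
      have i3 := mul_ib_bdd (cv_ib (hk_ib0 ha) (hi j s)) (cv_ib (dk_ib ha j) hφ).aestronglyMeasurable
        (cv_bdd hL hφ)
      refine integral_mono i3 ((i1.const_mul _).add (i2.const_mul _)) fun z => ?_
      simp only [Pi.add_apply]
      nlinarith [sq_nonneg (cv (dk j ((t-s)/2)) φ z -
        cv (fun w => heatKernel w ((t-s)/2)) (fun y => g j y s) z)]
    have q0 : ∀ j, 0 ≤ ∫ z, cv (fun w => heatKernel w ((t-s)/2)) (fun y => g j y s) z ^ 2 :=
      fun j => integral_nonneg fun z => sq_nonneg _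
    have p0 : ∀ j, 0 ≤ ∫ z, cv (dk j ((t-s)/2)) φ z ^ 2 :=
      fun j => integral_nonneg fun z => sq_nonneg _
    calc ENNReal.ofReal (-∑ j, ∫ x, φ x * FF (g j) j t x s)
        ≤ ENNReal.ofReal ((1/2) * (∑ j, ∫ z, cv (dk j ((t-s)/2)) φ z ^ 2) +
          (1/2) * ∑ j, ∫ z, cv (fun w => heatKernel w ((t-s)/2)) (fun y => g j y s) z ^ 2) := by
          apply ENNReal.ofReal_le_ofReal
          rw [← Finset.sum_neg_distrib, Finset.mul_sum, Finset.mul_sum, ← Finset.sum_add_distrib]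
          exact Finset.sum_le_sum fun j _ => e j
      _ = (1/2) * p (t - s) + (1/2) * ∑ j, ENNReal.ofReal
            (∫ z, cv (fun w => heatKernel w ((t-s)/2)) (fun y => g j y s) z ^ 2) := by
          have hh : ENNReal.ofReal (1/2) = 1/2 := by
            rw [ENNReal.ofReal_div_of_pos (by norm_num)]; simp
          rw [ENNReal.ofReal_add (mul_nonneg (by norm_num) (Finset.sum_nonneg fun j _ => p0 j))
            (mul_nonneg (by norm_num) (Finset.sum_nonneg fun j _ => q0 j)),
            ENNReal.ofReal_mul (by norm_num), ENNReal.ofReal_mul (by norm_num), hh,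
            ENNReal.ofReal_sum_of_nonneg (fun j _ => q0 j)]
      _ ≤ _ := by
          gcongr with j
          have := Q_le_WE ha (hi j s)
          rwa [h2] at this
  have hWm : Measurable (fun s => ∑ j, WE (fun y => ‖g j y s‖ₑ) (t - s)) := by
    refine Finset.measurable_fun_sum _ fun j _ => ?_
    exact (WE_meas (g := fun y s => ‖g j y s‖ₑ) (hg j).enorm).comp (f := fun s : ℝ => (s, t - s)) (by fun_prop)
  have hP : ∫⁻ s in Ioo (-1:ℝ) t, p (t - s) ≤ ENNReal.ofReal (∫ x, φ x ^ 2) := by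
    refine le_trans ?_ (E4 hφ hφ2)
    rw [← lintegral_indicator measurableSet_Ioo, ← lintegral_indicator measurableSet_Ioc]
    refine le_trans ?_ (lintegral_sub_left_eq_self _ t).le
    refine lintegral_mono fun s => ?_
    by_cases hs : s ∈ Ioo (-1:ℝ) t
    · have : t - s ∈ Ioc (0:ℝ) 1 := ⟨by linarith [hs.2], by linarith [hs.1]⟩
      simp only [indicator_of_mem hs, indicator_of_mem this]
      exact le_rfl
    · simp only [indicator_of_notMem hs]
      exact bot_le
  set A := ∫⁻ s in Ioo (-1:ℝ) t, ∑ j, WE (fun y => ‖g j y s‖ₑ) (t - s) with hA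
  have key : ENNReal.ofReal (∫ x, φ x ^ 2) ≤ (1/2) * ENNReal.ofReal (∫ x, φ x ^ 2) + (1/2) * A := by
    calc ENNReal.ofReal (∫ x, φ x ^ 2)
        ≤ ∫⁻ s in Ioo (-1:ℝ) t, ENNReal.ofReal (-∑ j, ∫ x, φ x * FF (g j) j t x s) := by
          rw [hN2]; exact ofReal_integral_le _
      _ ≤ ∫⁻ s in Ioo (-1:ℝ) t, ((1/2) * p (t - s) + (1/2) * ∑ j, WE (fun y => ‖g j y s‖ₑ) (t - s)) :=
          setLIntegral_mono' measurableSet_Ioo hpt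
      _ = (1/2) * (∫⁻ s in Ioo (-1:ℝ) t, p (t - s)) + (1/2) * A := by
          rw [lintegral_add_right _ (hWm.const_mul _), lintegral_const_mul' _ _ (by simp),
            lintegral_const_mul' _ _ (by simp)]
      _ ≤ _ := by gcongr
  rw [hN]
  rcases eq_or_ne A ⊤ with hAt | hAt
  · rw [hAt]; exact le_top
  set N := ENNReal.ofReal (∫ x, φ x ^ 2) with hNd
  have hNt : N ≠ ⊤ := ENNReal.ofReal_ne_top
  have h1t : (1/2) * N ≠ ⊤ := ENNReal.mul_ne_top (by simp) hNt
  have h2t : (1/2) * A ≠ ⊤ := ENNReal.mul_ne_top (by simp) hAt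
  have k2 := ENNReal.toReal_mono (ENNReal.add_ne_top.2 ⟨h1t, h2t⟩) key
  rw [ENNReal.toReal_add h1t h2t, ENNReal.toReal_mul, ENNReal.toReal_mul] at k2
  rw [← ENNReal.toReal_le_toReal hNt hAt]
  norm_num at k2
  linarith

lemma uu_sq_ib {g : Fin 3 → V3 → ℝ → ℝ} (hg : ∀ j, Measurable (fun p : V3 × ℝ => g j p.1 p.2))
    {K : ℝ} (hK : ∀ j y s, |g j y s| ≤ K) (t : ℝ) : IntegrableOn (fun x => uu g t x ^ 2) (Bfull 1) := by
  obtain ⟨C, hC⟩ := uu_bdd hK t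
  refine Measure.integrableOn_of_bounded (M := C^2) Bfull_fin.ne
    ((uu_meas hg t).pow_const 2).aestronglyMeasurable (ae_of_all _ fun x => ?_)
  rw [norm_pow]
  gcongr
  exact hC x

lemma WE_mono {f g : V3 → ℝ≥0∞} (h : ∀ y, f y ≤ g y) (τ : ℝ) : WE f τ ≤ WE g τ := by
  unfold WE
  gcongr with x y
  · exact h x
  · exact h y

lemma Hhat_eq (G : V3 → ℝ → (Fin 3 → Fin 3 → ℝ)) (i : Fin 3) (x : V3) (t : ℝ) :
    Hhat G i x t = uu (fun j y s => G y s i j) t x := by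
  unfold Hhat uu
  congr 1
  refine Finset.sum_congr rfl fun j _ => setIntegral_congr_fun measurableSet_Ioo fun s hs => ?_
  unfold FF cv
  have : 0 < t - s := sub_pos.2 hs.2
  simp only [pd_hk this]

/-- Frobenius norm -/
def fro (A : Fin 3 → Fin 3 → ℝ) : ℝ := Real.sqrt (∑ i, ∑ j, (A i j)^2)

lemma le_fro (A : Fin 3 → Fin 3 → ℝ) (i j : Fin 3) : |A i j| ≤ fro A := by
  unfold fro
  apply Real.abs_le_sqrt
  have h1 : (A i j)^2 ≤ ∑ j, (A i j)^2 :=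
    Finset.single_le_sum (f := fun j => (A i j)^2) (fun i _ => sq_nonneg _) (Finset.mem_univ j)
  have h2 : ∑ j, (A i j)^2 ≤ ∑ i, ∑ j, (A i j)^2 :=
    Finset.single_le_sum (f := fun i => ∑ j, (A i j)^2)
      (fun i _ => Finset.sum_nonneg fun _ _ => sq_nonneg _) (Finset.mem_univ i)
  exact h1.trans h2

theorem main_est (G : V3 → ℝ → (Fin 3 → Fin 3 → ℝ))
    (hGc : Continuous (fun z : V3 × ℝ => G z.1 z.2))
    (hGs : HasCompactSupport (fun z : V3 × ℝ => G z.1 z.2)) :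
    (∫ t in Ioo (-1:ℝ) 0, ∫ x in Bfull 1, ∑ i, (Hhat G i x t)^2) ≤
      90 * ∫ s in Ioo (-1:ℝ) 0, (∫ y : V3, (fro (G y s)) ^ ((6:ℝ)/5)) ^ ((5:ℝ)/3) := by
  -- continuity and bounds
  have hfc : Continuous (fun z : V3 × ℝ => fro (G z.1 z.2)) := by
    unfold fro
    fun_prop
  have hf0 : ∀ y s, 0 ≤ fro (G y s) := fun y s => Real.sqrt_nonneg _
  obtain ⟨R, hR⟩ := hGs.isCompact.isBounded.subset_closedBall (0 : V3 × ℝ)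
  have hz : ∀ y s, y ∉ Metric.closedBall (0:V3) R → G y s = 0 := by
    intro y s hy
    by_contra hne
    have : (y, s) ∈ tsupport (fun z : V3 × ℝ => G z.1 z.2) := subset_tsupport _ hne
    have := hR this
    rw [mem_closedBall_zero_iff] at this hy
    exact hy ((norm_fst_le (y, s)).trans this)
  have hfs : HasCompactSupport (fun z : V3 × ℝ => fro (G z.1 z.2)) :=
    hGs.comp_left (g := fro) (by simp [fro])
  obtain ⟨K, hK⟩ := hfs.exists_bound_of_continuous hfc
  have hfK : ∀ y s, fro (G y s) ≤ K := fun y s => (le_abs_self _).trans (hK (y, s))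
  have hGK : ∀ i j y s, |G y s i j| ≤ K := fun i j y s => (le_fro _ i j).trans (hfK y s)
  have hGm : ∀ i j, Measurable (fun p : V3 × ℝ => G p.1 p.2 i j) := fun i j =>
    Continuous.measurable (by fun_prop)
  have hGi : ∀ i j s, Integrable (fun y => G y s i j) := by
    intro i j s
    apply Continuous.integrable_of_hasCompactSupport
    · exact (show Continuous (fun p : V3 × ℝ => G p.1 p.2 i j) by fun_prop).comp
        (f := fun y : V3 => (y, s)) (by fun_prop)
    · exact HasCompactSupport.intro (isCompact_closedBall (0:V3) R) fun y hy => by simp [hz y s hy]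
  have hMi : ∀ s, Integrable (fun y => fro (G y s) ^ ((6:ℝ)/5)) := by
    intro s
    apply Continuous.integrable_of_hasCompactSupport
    · exact (hfc.comp (f := fun y : V3 => (y, s)) (by fun_prop)).rpow_const (fun y => Or.inr (by norm_num))
    · refine HasCompactSupport.intro (isCompact_closedBall (0:V3) R) fun y hy => ?_
      rw [hz y s hy]; simp [fro]
  set g : V3 → ℝ → ℝ≥0∞ := fun y s => ENNReal.ofReal (fro (G y s)) with hg
  have hgm : Measurable (fun p : V3 × ℝ => g p.1 p.2) := hfc.measurable.ennreal_ofReal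
  have hMeq : ∀ s, ∫⁻ y, g y s ^ (6/5:ℝ) = ENNReal.ofReal (∫ y : V3, (fro (G y s)) ^ ((6:ℝ)/5)) := by
    intro s
    rw [ofReal_integral_eq_lintegral_ofReal (hMi s) (ae_of_all _ fun y => by
      simp only [Pi.zero_apply]; have := hf0 y s; positivity)]
    congr 1; ext y
    rw [hg, ENNReal.ofReal_rpow_of_nonneg (hf0 y s) (by norm_num)]
  -- the pointwise in time bound
  have st1 : ∀ t ∈ Ioo (-1:ℝ) 0, ENNReal.ofReal (∫ x in Bfull 1, ∑ i, (Hhat G i x t)^2) ≤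
      9 * ∫⁻ s in Ioo (-1:ℝ) 0, WE (fun y => g y s) (t - s) := by
    intro t ht
    simp only [Hhat_eq]
    rw [integral_finsetSum _ (fun i _ => uu_sq_ib (g := fun j y s => G y s i j) (hGm i) (hGK i) t),
      ENNReal.ofReal_sum_of_nonneg (fun i _ => integral_nonneg fun x => sq_nonneg _)]
    calc _ ≤ ∑ i : Fin 3, 3 * ∫⁻ s in Ioo (-1:ℝ) 0, WE (fun y => g y s) (t - s) := by
          refine Finset.sum_le_sum fun i _ => ?_
          refine (S1 (g := fun j y s => G y s i j) (hGm i) (hGK i) (hGi i) ht.2).trans ?_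
          calc _ ≤ ∫⁻ s in Ioo (-1:ℝ) t, 3 * WE (fun y => g y s) (t - s) := by
                gcongr with s
                calc _ ≤ ∑ j : Fin 3, WE (fun y => g y s) (t - s) := by
                      refine Finset.sum_le_sum fun j _ => WE_mono (fun y => ?_) _
                      rw [Real.enorm_eq_ofReal_abs]
                      exact ENNReal.ofReal_le_ofReal (le_fro _ _ _)
                  _ = _ := by simp
            _ = 3 * ∫⁻ s in Ioo (-1:ℝ) t, WE (fun y => g y s) (t - s) :=
                lintegral_const_mul' _ _ (by simp)
            _ ≤ _ := by
                gcongr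
                exact ht.2.le
      _ = _ := by
          simp only [Finset.sum_const, Finset.card_univ, Fintype.card_fin, nsmul_eq_mul]
          rw [← mul_assoc]; norm_num
  have st2 : ∫⁻ t in Ioo (-1:ℝ) 0, ∫⁻ s in Ioo (-1:ℝ) 0, WE (fun y => g y s) (t - s) ≤
      10 * ∫⁻ s in Ioo (-1:ℝ) 0, ENNReal.ofReal ((∫ y : V3, (fro (G y s)) ^ ((6:ℝ)/5)) ^ ((5:ℝ)/3)) := by
    calc _ ≤ ∫⁻ t, ∫⁻ s in Ioo (-1:ℝ) 0, WE (fun y => g y s) (t - s) := setLIntegral_le_lintegral _ _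
      _ = ∫⁻ s in Ioo (-1:ℝ) 0, ∫⁻ t, WE (fun y => g y s) (t - s) := by
          rw [lintegral_lintegral_swap]
          exact ((WE_meas hgm).comp (f := fun q : ℝ × ℝ => (q.2, q.1 - q.2)) (by fun_prop)).aemeasurable
      _ ≤ ∫⁻ s in Ioo (-1:ℝ) 0, 10 * ENNReal.ofReal ((∫ y : V3, (fro (G y s)) ^ ((6:ℝ)/5)) ^ ((5:ℝ)/3)) := by
          gcongr with s
          rw [lintegral_sub_right_eq_self (fun τ => WE (fun y => g y s) τ)]
          have := HLS (g := fun y => g y s) (hgm.comp (f := fun y : V3 => (y, s)) (by fun_prop))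
            (fun y => ENNReal.ofReal_ne_top) (by rw [hMeq]; exact ENNReal.ofReal_ne_top)
          rw [hMeq, ENNReal.ofReal_rpow_of_nonneg (integral_nonneg fun y => by
            simp only [Pi.zero_apply]; have := hf0 y s; positivity) (by norm_num)] at this
          exact this
      _ = _ := lintegral_const_mul' _ _ (by simp)
  have hRm : StronglyMeasurable (fun s => ∫ y : V3, (fro (G y s)) ^ ((6:ℝ)/5)) := by
    refine StronglyMeasurable.integral_prod_right' (f := fun q : ℝ × V3 => (fro (G q.2 q.1)) ^ ((6:ℝ)/5)) ?_
    have : Measurable (fun q : ℝ × V3 => fro (G q.2 q.1)) :=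
      hfc.measurable.comp (f := fun q : ℝ × V3 => (q.2, q.1)) (by fun_prop)
    exact (this.pow_const _).stronglyMeasurable
  have hM0 : ∀ s, 0 ≤ ∫ y : V3, (fro (G y s)) ^ ((6:ℝ)/5) := fun s => integral_nonneg fun y => by
    simp only [Pi.zero_apply]; have := hf0 y s; positivity
  have hMb : ∀ s, ∫ y : V3, (fro (G y s)) ^ ((6:ℝ)/5) ≤
      ∫ y in Metric.closedBall (0:V3) R, K ^ ((6:ℝ)/5) := by
    intro s
    rw [← integral_indicator Metric.isClosed_closedBall.measurableSet]
    refine integral_mono (hMi s) ?_ fun y => ?_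
    · rw [integrable_indicator_iff Metric.isClosed_closedBall.measurableSet]
      exact integrableOn_const (measure_closedBall_lt_top.ne)
    · by_cases hy : y ∈ Metric.closedBall (0:V3) R
      · simp only [indicator_of_mem hy]
        exact Real.rpow_le_rpow (hf0 y s) (hfK y s) (by norm_num)
      · simp only [indicator_of_notMem hy]
        rw [hz y s hy]; simp [fro]
  have hRi : IntegrableOn (fun s => (∫ y : V3, (fro (G y s)) ^ ((6:ℝ)/5)) ^ ((5:ℝ)/3)) (Ioo (-1:ℝ) 0) := by
    refine Measure.integrableOn_of_bounded
      (M := (∫ y in Metric.closedBall (0:V3) R, K ^ ((6:ℝ)/5)) ^ ((5:ℝ)/3)) (by simp)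
      (hRm.measurable.pow_const _).aestronglyMeasurable (ae_of_all _ fun s => ?_)
    rw [Real.norm_of_nonneg (Real.rpow_nonneg (hM0 s) _)]
    exact Real.rpow_le_rpow (hM0 s) (hMb s) (by norm_num)
  have hR0 : 0 ≤ ∫ s in Ioo (-1:ℝ) 0, (∫ y : V3, (fro (G y s)) ^ ((6:ℝ)/5)) ^ ((5:ℝ)/3) :=
    integral_nonneg fun s => Real.rpow_nonneg (hM0 s) _
  rw [← ENNReal.ofReal_le_ofReal_iff (by positivity)]
  calc _ ≤ ∫⁻ t in Ioo (-1:ℝ) 0, ENNReal.ofReal (∫ x in Bfull 1, ∑ i, (Hhat G i x t)^2) :=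
        ofReal_integral_le _
    _ ≤ ∫⁻ t in Ioo (-1:ℝ) 0, 9 * ∫⁻ s in Ioo (-1:ℝ) 0, WE (fun y => g y s) (t - s) :=
        setLIntegral_mono' measurableSet_Ioo st1
    _ = 9 * ∫⁻ t in Ioo (-1:ℝ) 0, ∫⁻ s in Ioo (-1:ℝ) 0, WE (fun y => g y s) (t - s) :=
        lintegral_const_mul' _ _ (by simp)
    _ ≤ 9 * (10 * ∫⁻ s in Ioo (-1:ℝ) 0, ENNReal.ofReal ((∫ y : V3, (fro (G y s)) ^ ((6:ℝ)/5)) ^ ((5:ℝ)/3))) := by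
        gcongr
    _ = _ := by
        rw [← ofReal_integral_eq_lintegral_ofReal hRi (ae_of_all _ fun s => Real.rpow_nonneg (hM0 s) _),
          ENNReal.ofReal_mul (by norm_num), ← mul_assoc]
        norm_num

/-- L_{6/5,2} → L₂ estimate for the gradient heat potential
(inequality (imbedding)). -/
theorem heat_potential_estimate :
    ∃ c : ℝ, 0 < c ∧
      ∀ G : V3 → ℝ → (Fin 3 → Fin 3 → ℝ),
        ContDiff ℝ (⊤ : ℕ∞) (fun z : V3 × ℝ => G z.1 z.2) →
        HasCompactSupport (fun z : V3 × ℝ => G z.1 z.2) →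
        tsupport (fun z : V3 × ℝ => G z.1 z.2) ⊆ univ ×ˢ Ioo (-1 : ℝ) 0 →
        (∫ t in Ioo (-1:ℝ) 0, ∫ x in Bfull 1, ∑ i, (Hhat G i x t)^2) ^ ((1:ℝ)/2)
          ≤ c * (∫ s in Ioo (-1:ℝ) 0,
              (∫ y : V3, (Real.sqrt (∑ i, ∑ j, (G y s i j)^2)) ^ ((6:ℝ)/5))
                ^ ((5:ℝ)/3)) ^ ((1:ℝ)/2) := by
  refine ⟨10, by norm_num, fun G hG hGs _ => ?_⟩
  have h := main_est G hG.continuous hGs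
  unfold fro at h
  have hR0 : 0 ≤ ∫ s in Ioo (-1:ℝ) 0,
      (∫ y : V3, (Real.sqrt (∑ i, ∑ j, (G y s i j)^2)) ^ ((6:ℝ)/5)) ^ ((5:ℝ)/3) :=
    integral_nonneg fun s => Real.rpow_nonneg (integral_nonneg fun y =>
      Real.rpow_nonneg (Real.sqrt_nonneg _) _) _
  have hL0 : 0 ≤ ∫ t in Ioo (-1:ℝ) 0, ∫ x in Bfull 1, ∑ i, (Hhat G i x t)^2 :=
    integral_nonneg fun t => integral_nonneg fun x => Finset.sum_nonneg fun i _ => sq_nonneg _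
  rw [← Real.sqrt_eq_rpow, ← Real.sqrt_eq_rpow]
  refine (Real.sqrt_le_sqrt (h.trans (mul_le_mul_of_nonneg_right (show (90:ℝ) ≤ 10^2 by norm_num) hR0))).trans ?_
  rw [Real.sqrt_mul (by norm_num), Real.sqrt_sq (by norm_num)]
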